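/- arXiv:1507.05319 — 4 statements merged into one kernel-verified Lean document; each statement's English description precedes it below -/
import Mathlib

section
/- Let n ≥ 2 be an integer and let C ⊂ ℝ^{n+1} be a Cantor set. Then there exists a topological embedding f : Sⁿ → ℝ^{n+1} with C ⊆ f(Sⁿ); that is, every Cantor set in ℝ^{n+1} lies on a topologically embedded n-sphere. -/
open Metric Topology

/-- A Cantor set: a nonempty, compact, perfect, totally disconnected subset. -/
def IsCantorSet {X : Type*} [TopologicalSpace X] (C : Set X) : Prop :=
  C.Nonempty ∧ IsCompact C ∧ Perfect C ∧ IsTotallyDisconnected C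


/-! ### Part 1: planar non-separation -/

lemma exists_log_on {X : Type*} [TopologicalSpace X] [CompactSpace X] [T2Space X]
    [TotallyDisconnectedSpace X] (φ : X → ℂ) (hφ : Continuous φ) (h0 : ∀ x, φ x ≠ 0)
    (Z : Set X) (hZc : IsClosed Z) (hZ : ∀ x ∈ Z, φ x ∈ Complex.slitPlane) :
    ∃ g : C(X, ℂ), (∀ x, Complex.exp (g x) = φ x) ∧ ∀ x ∈ Z, g x = Complex.log (φ x) := by
  classical
  have key : ∃ U : Set X, IsClopen U ∧ Set.univ ⊆ U ∧ ∃ g : X → ℂ, Continuous g ∧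
      (∀ x ∈ U, Complex.exp (g x) = φ x) ∧ ∀ x ∈ U, x ∈ Z → g x = Complex.log (φ x) := by
    refine IsCompact.induction_on (isCompact_univ (X := X))
      (p := fun s => ∃ U : Set X, IsClopen U ∧ s ⊆ U ∧ ∃ g : X → ℂ, Continuous g ∧
      (∀ x ∈ U, Complex.exp (g x) = φ x) ∧ ∀ x ∈ U, x ∈ Z → g x = Complex.log (φ x)) ?_ ?_ ?_ ?_
    · exact ⟨∅, isClopen_empty, subset_rfl, fun _ => 0, continuous_const, by simp, by simp⟩
    · rintro s t hst ⟨U, hU, htU, h⟩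
      exact ⟨U, hU, hst.trans htU, h⟩
    · rintro s t ⟨U, hU, hsU, g, hg, hg1, hg2⟩ ⟨V, hV, htV, k, hk, hk1, hk2⟩
      refine ⟨U ∪ V, hU.union hV, Set.union_subset_union hsU htV, U.piecewise g k, ?_, ?_, ?_⟩
      · exact hg.piecewise (by simp [hU.frontier_eq]) hk
      · rintro x hx
        by_cases hxU : x ∈ U
        · simp [hxU, hg1]
        · simp [hxU, hk1 x (hx.resolve_left hxU)]
      · rintro x hx hz
        by_cases hxU : x ∈ U
        · simp [hxU, hg2 x hxU hz]
        · simp [hxU, hk2 x (hx.resolve_left hxU) hz]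
    · intro x _
      -- local
      suffices h : ∃ O : Set X, IsOpen O ∧ x ∈ O ∧ ∃ g : X → ℂ, ContinuousOn g O ∧
          (∀ x ∈ O, Complex.exp (g x) = φ x) ∧ ∀ x ∈ O, x ∈ Z → g x = Complex.log (φ x) by
        obtain ⟨O, hO, hxO, g, hg, hg1, hg2⟩ := h
        obtain ⟨U, hU, hxU, hUO⟩ := compact_exists_isClopen_in_isOpen hO hxO
        refine ⟨U, ?_, U, hU, subset_rfl, U.piecewise g 0, ?_, ?_, ?_⟩
        · exact mem_nhdsWithin_of_mem_nhds (hU.isOpen.mem_nhds hxU)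
        · refine continuous_iff_continuousAt.2 fun y => ?_
          by_cases hy : y ∈ U
          · have : ContinuousAt g y := (hg y (hUO hy)).continuousAt (hO.mem_nhds (hUO hy))
            refine this.congr ?_
            filter_upwards [hU.isOpen.mem_nhds hy] with z hz
            simp [hz]
          · have : ContinuousAt (0 : X → ℂ) y := continuous_zero.continuousAt
            refine this.congr ?_
            filter_upwards [hU.compl.isOpen.mem_nhds hy] with z hz
            simp [Set.piecewise, show z ∉ U from hz]
        · intro y hy; simp [hy, hg1 y (hUO hy)]
        · intro y hy hz; simp [hy, hg2 y (hUO hy) hz]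
      by_cases hx : φ x ∈ Complex.slitPlane
      · refine ⟨φ ⁻¹' Complex.slitPlane, Complex.isOpen_slitPlane.preimage hφ, hx,
          fun y => Complex.log (φ y), ?_, ?_, ?_⟩
        · exact hφ.continuousOn.clog (fun y hy => hy)
        · intro y _; exact Complex.exp_log (h0 y)
        · intros; rfl
      · refine ⟨Zᶜ ∩ (fun y => φ y / φ x) ⁻¹' Complex.slitPlane, ?_, ?_,
          fun y => Complex.log (φ y / φ x) + Complex.log (φ x), ?_, ?_, ?_⟩
        · exact hZc.isOpen_compl.inter (Complex.isOpen_slitPlane.preimage (hφ.div_const _))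
        · refine ⟨fun hz => hx (hZ x hz), ?_⟩
          simp [div_self (h0 x)]
        · refine ContinuousOn.add (ContinuousOn.clog (hφ.div_const _).continuousOn ?_)
            continuousOn_const
          intro y hy; exact hy.2
        · intro y _
          rw [Complex.exp_add, Complex.exp_log (div_ne_zero (h0 y) (h0 x)),
            Complex.exp_log (h0 x), div_mul_cancel₀ _ (h0 x)]
        · intro y hy hz; exact absurd hz hy.1
  obtain ⟨U, _, hU, g, hg, h1, h2⟩ := key
  exact ⟨⟨g, hg⟩, fun x => h1 x (hU trivial), fun x hx => h2 x (hU trivial) hx⟩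

lemma exists_log_closedBall (F : ℂ → ℂ) (R : ℝ) (hR : 0 < R)
    (hF : ContinuousOn F (closedBall 0 R)) (h0 : ∀ x ∈ closedBall (0 : ℂ) R, F x ≠ 0) :
    ∃ G : ℂ → ℂ, ContinuousOn G (closedBall 0 R) ∧
      ∀ x ∈ closedBall (0 : ℂ) R, Complex.exp (G x) = F x := by
  have hK : IsCompact (closedBall (0 : ℂ) R) := isCompact_closedBall 0 R
  obtain ⟨z, hz, hzmin⟩ := hK.exists_isMinOn ⟨0, by simp [hR.le]⟩ hF.norm
  have hm : 0 < ‖F z‖ := norm_pos_iff.2 (h0 z hz)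
  obtain ⟨δ, hδ, hunif⟩ := Metric.uniformContinuousOn_iff.1
    (hK.uniformContinuousOn_of_continuous hF) ‖F z‖ hm
  obtain ⟨n, hn⟩ := exists_nat_gt (R / δ)
  have hn0 : (0 : ℝ) < n := lt_of_le_of_lt (by positivity) hn
  have hmem : ∀ x ∈ closedBall (0 : ℂ) R, ∀ k ≤ n, ((k : ℂ) / n) * x ∈ closedBall (0 : ℂ) R := by
    intro x hx k hk
    simp only [mem_closedBall, dist_zero_right] at hx ⊢
    rw [norm_mul, norm_div, Complex.norm_natCast, Complex.norm_natCast]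
    have : (k : ℝ) / n ≤ 1 := by
      rw [div_le_one hn0]; exact_mod_cast hk
    calc _ ≤ 1 * ‖x‖ := by gcongr
      _ ≤ R := by simpa using hx
  have hslit : ∀ x ∈ closedBall (0 : ℂ) R, ∀ k < n,
      F (((k + 1 : ℕ) : ℂ) / n * x) / F ((k : ℂ) / n * x) ∈ Complex.slitPlane := by
    intro x hx k hk
    have h1 := hmem x hx k hk.le
    have h2 := hmem x hx (k + 1) hk
    have hd : dist (((k + 1 : ℕ) : ℂ) / n * x) ((k : ℂ) / n * x) < δ := by
      rw [dist_eq_norm, ← sub_mul, ← sub_div]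
      push_cast
      rw [add_sub_cancel_left, norm_mul, norm_div, Complex.norm_natCast, norm_one]
      simp only [mem_closedBall, dist_zero_right] at hx
      rw [div_lt_iff₀ hδ] at hn
      rw [div_mul_eq_mul_div, div_lt_iff₀ hn0, one_mul]
      linarith [mul_comm δ (n : ℝ)]
    have h3 := hunif _ h2 _ h1 hd
    have h4 : ‖F z‖ ≤ ‖F ((k : ℂ) / n * x)‖ := hzmin h1
    have hne := h0 _ h1
    have : F (((k + 1 : ℕ) : ℂ) / n * x) / F ((k : ℂ) / n * x) =
        1 + (F (((k + 1 : ℕ) : ℂ) / n * x) - F ((k : ℂ) / n * x)) / F ((k : ℂ) / n * x) := by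
      rw [sub_div, div_self hne]; ring
    rw [this]
    apply Complex.mem_slitPlane_of_norm_lt_one
    rw [norm_div, div_lt_one (norm_pos_iff.2 hne), ← dist_eq_norm]
    linarith
  have hcont : ∀ k ≤ n, ContinuousOn (fun x => F ((k : ℂ) / n * x)) (closedBall 0 R) := by
    intro k hk
    exact hF.comp (by fun_prop) (fun x hx => hmem x hx k hk)
  refine ⟨fun x => Complex.log (F 0) + ∑ k ∈ Finset.range n,
    Complex.log (F (((k + 1 : ℕ) : ℂ) / n * x) / F ((k : ℂ) / n * x)), ?_, ?_⟩
  · refine continuousOn_const.add (continuousOn_finsetSum _ fun k hk => ?_)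
    have hk := Finset.mem_range.1 hk
    refine ContinuousOn.clog ?_ (fun x hx => hslit x hx k hk)
    exact (hcont (k + 1) hk).div (hcont k hk.le) (fun x hx => h0 _ (hmem x hx k hk.le))
  · intro x hx
    have : ∀ j ≤ n, Complex.exp (Complex.log (F 0) + ∑ k ∈ Finset.range j,
        Complex.log (F (((k + 1 : ℕ) : ℂ) / n * x) / F ((k : ℂ) / n * x))) = F ((j : ℂ) / n * x) := by
      intro j
      induction j with
      | zero =>
        intro _
        simp [Complex.exp_log (h0 0 (by simp [hR.le]))]
      | succ j ih =>
        intro hj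
        rw [Finset.sum_range_succ, ← add_assoc, Complex.exp_add, ih (by omega),
          Complex.exp_log (div_ne_zero (h0 _ (hmem x hx _ hj)) (h0 _ (hmem x hx _ (by omega)))),
          mul_div_cancel₀ _ (h0 _ (hmem x hx _ (by omega)))]
    have h := this n le_rfl
    rwa [div_self (by exact_mod_cast hn0.ne'), one_mul] at h

lemma contOn_ite {s A A' : Set ℂ} {f1 f2 : ℂ → ℂ} [DecidablePred (· ∈ A')] (hA : IsOpen A)
    (hA' : IsOpen A')
    (hd : Disjoint A A') (h1 : ∀ x ∈ s, x ∉ A → ContinuousWithinAt f1 s x)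
    (h2 : ∀ x ∈ s, x ∉ A' → ContinuousWithinAt f2 s x)
    (heq : ∀ x ∈ s, x ∉ A → x ∉ A' → f1 x = f2 x) :
    ContinuousOn (fun x => if x ∈ A' then f1 x else f2 x) s := by
  intro x hx
  by_cases hxA' : x ∈ A'
  · refine (h1 x hx (fun h => hd.le_bot ⟨h, hxA'⟩)).congr_of_eventuallyEq ?_ (by simp [hxA'])
    filter_upwards [mem_nhdsWithin_of_mem_nhds (hA'.mem_nhds hxA')] with y hy
    simp [hy]
  · by_cases hxA : x ∈ A
    · refine (h2 x hx hxA').congr_of_eventuallyEq ?_ (by simp [hxA'])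
      filter_upwards [mem_nhdsWithin_of_mem_nhds (hA.mem_nhds hxA)] with y hy
      have : y ∉ A' := fun h => hd.le_bot ⟨hy, h⟩
      simp [this]
    · have e := heq x hx hxA hxA'
      have t1 := h1 x hx hxA
      have t2 := h2 x hx hxA'
      unfold ContinuousWithinAt at t1 t2 ⊢
      simp only [hxA', if_false]
      rw [e] at t1
      exact t1.if' t2

lemma no_log_on_circle (N : ℂ → ℂ) (hN : ContinuousOn N (sphere 0 3))
    (h : ∀ x ∈ sphere (0 : ℂ) 3, Complex.exp (N x) = x) : False := by
  set c : ℝ → ℂ := fun t => 3 * Complex.exp (t * Complex.I) with hc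
  have hcs : ∀ t, c t ∈ sphere (0 : ℂ) 3 := by
    intro t; simp [hc, Complex.norm_exp_ofReal_mul_I]
  have hcc : Continuous c := by fun_prop
  have hNc : Continuous (fun t => N (c t)) := by
    rw [← continuousOn_univ]
    exact hN.comp hcc.continuousOn (fun t _ => hcs t)
  set u : ℝ → ℝ := fun t => ((N (c t)).im - t) / (2 * Real.pi) with hu
  have huc : Continuous u := by
    have := Complex.continuous_im.comp hNc
    exact (this.sub continuous_id).div_const _
  have hZval : ∀ t, ∃ m : ℤ, u t = m := by
    intro t
    have h1 : Complex.exp (N (c t)) = Complex.exp (Real.log 3 + t * Complex.I) := by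
      rw [h _ (hcs t), Complex.exp_add, ← Complex.ofReal_exp, Real.exp_log (by norm_num)]
      simp [hc]
    obtain ⟨m, hm⟩ := Complex.exp_eq_exp_iff_exists_int.1 h1
    refine ⟨m, ?_⟩
    have : (N (c t)).im = t + m * (2 * Real.pi) := by
      rw [hm]; generalize Real.log 3 = r; simp
    simp only [hu, this]
    have := Real.pi_pos
    field_simp; ring
  have hper : c (2 * Real.pi) = c 0 := by
    simp [hc, Complex.exp_two_pi_mul_I]
  have hu1 : u (2 * Real.pi) = u 0 - 1 := by
    simp only [hu, hper]
    have := Real.pi_pos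
    field_simp; ring
  have hivt := intermediate_value_Icc' (a := 0) (b := 2 * Real.pi) (by positivity) huc.continuousOn
  obtain ⟨t, _, ht⟩ := hivt (show u 0 - 1 / 2 ∈ Set.Icc (u (2 * Real.pi)) (u 0) by
    rw [hu1]; constructor <;> linarith)
  obtain ⟨a, ha⟩ := hZval 0
  obtain ⟨b, hb⟩ := hZval t
  rw [ha, hb] at ht
  have : (2 * b : ℝ) = 2 * a - 1 := by linarith
  have : 2 * b = 2 * a - 1 := by exact_mod_cast this
  omega

lemma planar_nonsep (K A A' : Set ℂ) (hK : IsCompact K) (hKd : IsTotallyDisconnected K)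
    (hA : IsOpen A) (hA' : IsOpen A') (hd : Disjoint A A')
    (hcov : closedBall 0 3 ⊆ A ∪ A' ∪ K) (hAK : Disjoint A K) (hAK' : Disjoint A' K)
    (h0 : (0 : ℂ) ∈ A) (h1 : (1 : ℂ) ∈ A') : False := by
  classical
  have h1A : (1 : ℂ) ∉ A := fun h => hd.le_bot ⟨h, h1⟩
  have h0A' : (0 : ℂ) ∉ A' := fun h => hd.le_bot ⟨h0, h⟩
  have h0K : (0 : ℂ) ∉ K := fun h => hAK.le_bot ⟨h0, h⟩
  have h1K : (1 : ℂ) ∉ K := fun h => hAK'.le_bot ⟨h1, h⟩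
  have : CompactSpace K := isCompact_iff_compactSpace.1 hK
  have : TotallyDisconnectedSpace K := totallyDisconnectedSpace_subtype_iff.2 hKd
  have hslit : ∀ x : ℂ, 3 ≤ ‖x‖ → x / (x - 1) ∈ Complex.slitPlane := by
    intro x hx
    have hx1 : 2 ≤ ‖x - 1‖ := by
      have := norm_sub_norm_le x 1
      simp at this; linarith
    have hne : x - 1 ≠ 0 := by rw [← norm_pos_iff]; linarith
    have : x / (x - 1) = 1 + 1 / (x - 1) := by field_simp; ring
    rw [this]
    apply Complex.mem_slitPlane_of_norm_lt_one
    rw [norm_div, norm_one, div_lt_one (by linarith)]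
    linarith
  have hne1 : ∀ x : K, (x : ℂ) - 1 ≠ 0 := fun x hx => h1K (by rw [← sub_eq_zero.1 hx]; exact x.2)
  have hne0 : ∀ x : K, (x : ℂ) ≠ 0 := fun x hx => h0K (by rw [← hx]; exact x.2)
  obtain ⟨g0, hg0, hg0Z⟩ := exists_log_on (fun x : K => (x : ℂ) / (x - 1))
    (Continuous.div (by fun_prop) (by fun_prop) hne1)
    (fun x => div_ne_zero (hne0 x) (hne1 x)) {x | 3 ≤ ‖(x : ℂ)‖}
    (isClosed_le continuous_const (by fun_prop)) (fun x hx => hslit x hx)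
  obtain ⟨g, hg⟩ := ContinuousMap.exists_restrict_eq hK.isClosed g0
  have hgK : ∀ x (hx : x ∈ K), g x = g0 ⟨x, hx⟩ := by
    intro x hx; rw [← hg]; rfl
  have hgexp : ∀ x ∈ K, Complex.exp (g x) = x / (x - 1) := fun x hx => by
    rw [hgK x hx, hg0]
  have hgZ : ∀ x ∈ K, 3 ≤ ‖x‖ → g x = Complex.log (x / (x - 1)) := fun x hx h3 => by
    rw [hgK x hx, hg0Z _ h3]
  have hinK : ∀ x ∈ closedBall (0 : ℂ) 3, x ∉ A → x ∉ A' → x ∈ K := by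
    intro x hx h h'
    rcases hcov hx with (h2 | h2) | h2
    · exact absurd h2 h
    · exact absurd h2 h'
    · exact h2
  have n0 : ∀ x, x ∉ A → x ≠ 0 := fun x h e => h (e ▸ h0)
  have n1 : ∀ x, x ∉ A' → x - 1 ≠ 0 := fun x h e => h (by rw [sub_eq_zero.1 e]; exact h1)
  obtain ⟨G, hGc, hG⟩ := exists_log_closedBall
    (fun x => if x ∈ A' then Complex.exp (g x) / x else 1 / (x - 1)) 3 (by norm_num)
    (contOn_ite hA hA' hd
      (fun x _ hx' => ContinuousAt.continuousWithinAt
        (ContinuousAt.div (by fun_prop) (by fun_prop) (n0 x hx')))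
      (fun x _ hx' => ContinuousAt.continuousWithinAt
        (ContinuousAt.div (by fun_prop) (by fun_prop) (n1 x hx')))
      (fun x hx h h' => by
        rw [hgexp x (hinK x hx h h')]
        have := n0 x h
        have := n1 x h'
        field_simp))
    (fun x _ => by
      by_cases h : x ∈ A'
      · simp only [h, if_true]
        exact div_ne_zero (Complex.exp_ne_zero _) (fun e => h0A' (e ▸ h))
      · simp only [h, if_false]
        exact one_div_ne_zero (n1 x h))
  have hsub : sphere (0 : ℂ) 3 ⊆ closedBall 0 3 := sphere_subset_closedBall
  have hnorm : ∀ x ∈ sphere (0 : ℂ) 3, 3 ≤ ‖x‖ := fun x hx => by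
    rw [mem_sphere_zero_iff_norm] at hx; exact hx.ge
  refine no_log_on_circle
    (fun x => (if x ∈ A' then g x else Complex.log (x / (x - 1))) - G x) ?_ ?_
  · refine ContinuousOn.sub ?_ (hGc.mono hsub)
    refine contOn_ite hA hA' hd (fun x _ _ => g.continuous.continuousWithinAt) ?_ ?_
    · intro x hx h
      refine ContinuousAt.continuousWithinAt (ContinuousAt.clog
        (ContinuousAt.div (by fun_prop) (by fun_prop) (n1 x h)) (hslit x (hnorm x hx)))
    · intro x hx h h'
      exact hgZ x (hinK x (hsub hx) h h') (hnorm x hx)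
  · intro x hx
    have hx0 : x ≠ 0 := by
      rw [← norm_pos_iff]; linarith [hnorm x hx]
    rw [Complex.exp_sub, hG x (hsub hx)]
    by_cases h : x ∈ A'
    · simp only [h, if_true]
      have := Complex.exp_ne_zero (g x)
      field_simp
    · simp only [h, if_false]
      have := n1 x h
      rw [Complex.exp_log (div_ne_zero hx0 this)]
      field_simp

/-! ### Part 2: non-separation in higher dimension -/

section PartTwo

variable {E : Type*} [NormedAddCommGroup E] [NormedSpace ℝ E]

lemma nonsep_of_local {V F : Set E} (hVc : IsPreconnected V)
    (hloc : ∀ x ∈ V, ∃ r > 0, ball x r ⊆ V ∧ ∀ p ∈ ball x r \ F, ∀ q ∈ ball x r \ F,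
      ∃ T ⊆ V \ F, IsPreconnected T ∧ p ∈ T ∧ q ∈ T)
    (hF : ∀ O : Set E, IsOpen O → O.Nonempty → (O \ F).Nonempty) :
    IsPreconnected (V \ F) := by
  refine isPreconnected_of_forall_pair fun p hp q hq => ?_
  set Q := connectedComponentIn (V \ F) p with hQ
  have hpQ : p ∈ Q := mem_connectedComponentIn hp
  refine ⟨Q, connectedComponentIn_subset _ _, hpQ, ?_, isPreconnected_connectedComponentIn⟩
  have hdich : ∀ x ∈ V, ∃ r > 0, (ball x r \ F ⊆ Q) ∨ Disjoint (ball x r \ F) Q := by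
    intro x hx
    obtain ⟨r, hr, hrV, h⟩ := hloc x hx
    refine ⟨r, hr, ?_⟩
    by_cases hd : Disjoint (ball x r \ F) Q
    · exact Or.inr hd
    · left
      obtain ⟨a, ha, haQ⟩ := Set.not_disjoint_iff.1 hd
      intro b hb
      obtain ⟨T, hT, hTc, haT, hbT⟩ := h a ha b hb
      have h1 : T ⊆ connectedComponentIn (V \ F) a := hTc.subset_connectedComponentIn haT hT
      rw [hQ, connectedComponentIn_eq haQ]
      exact h1 hbT
  set T1 := ⋃ x ∈ {x : E × ℝ | 0 < x.2 ∧ ball x.1 x.2 \ F ⊆ Q}, ball x.1 x.2 with hT1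
  set T2 := ⋃ x ∈ {x : E × ℝ | 0 < x.2 ∧ Disjoint (ball x.1 x.2 \ F) Q}, ball x.1 x.2 with hT2
  have ho1 : IsOpen T1 := isOpen_biUnion fun _ _ => isOpen_ball
  have ho2 : IsOpen T2 := isOpen_biUnion fun _ _ => isOpen_ball
  have hcov : V ⊆ T1 ∪ T2 := by
    intro x hx
    obtain ⟨r, hr, h | h⟩ := hdich x hx
    · exact Or.inl (Set.mem_biUnion (x := (x, r)) ⟨hr, h⟩ (mem_ball_self hr))
    · exact Or.inr (Set.mem_biUnion (x := (x, r)) ⟨hr, h⟩ (mem_ball_self hr))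
  have h1Q : ∀ y ∈ T1, y ∉ F → y ∈ Q := by
    intro y hy hyF
    obtain ⟨x, hx, hyx⟩ := Set.mem_iUnion₂.1 hy
    exact hx.2 ⟨hyx, hyF⟩
  have h2Q : ∀ y ∈ T2, y ∉ F → y ∉ Q := by
    intro y hy hyF hyQ
    obtain ⟨x, hx, hyx⟩ := Set.mem_iUnion₂.1 hy
    exact hx.2.le_bot ⟨⟨hyx, hyF⟩, hyQ⟩
  have hp1 : p ∈ T1 := by
    rcases hcov hp.1 with h | h
    · exact h
    · exact absurd hpQ (h2Q p h hp.2)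
  rcases hcov hq.1 with h | h
  · exact h1Q q h hq.2
  · obtain ⟨y, _, hy⟩ := hVc T1 T2 ho1 ho2 hcov ⟨p, hp.1, hp1⟩ ⟨q, hq.1, h⟩
    obtain ⟨z, hz, hzF⟩ := hF (T1 ∩ T2) (ho1.inter ho2) ⟨y, hy⟩
    exact absurd (h1Q z hz.1 hzF) (h2Q z hz.2 hzF)

lemma td_compl_dense [Nontrivial E] {D : Set E} (hD : IsTotallyDisconnected D)
    (O : Set E) (hO : IsOpen O) (hne : O.Nonempty) : (O \ D).Nonempty := by
  by_contra h
  rw [Set.not_nonempty_iff_eq_empty, Set.sdiff_eq_empty] at h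
  obtain ⟨x, hx⟩ := hne
  obtain ⟨r, hr, hrO⟩ := Metric.isOpen_iff.1 hO x hx
  have hs := hD (ball x r) (hrO.trans h) (convex_ball x r).isPreconnected
  obtain ⟨v, hv⟩ := exists_ne (0 : E)
  have hv' : 0 < ‖v‖ := norm_pos_iff.2 hv
  have : x + (r / 2 / ‖v‖) • v ∈ ball x r := by
    rw [mem_ball, dist_eq_norm, add_sub_cancel_left, norm_smul, Real.norm_of_nonneg (by positivity),
      div_mul_cancel₀ _ hv'.ne']
    linarith
  have h2 := hs this (mem_ball_self hr)
  rw [add_eq_left, smul_eq_zero] at h2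
  rcases h2 with h2 | h2
  · have : 0 < r / 2 / ‖v‖ := by positivity
    linarith
  · exact hv h2

lemma nonsep_td [FiniteDimensional ℝ E] (hE : 1 < Module.finrank ℝ E)
    {V D : Set E} (hV : IsOpen V) (hVc : IsPreconnected V)
    (hD : IsCompact D) (hDd : IsTotallyDisconnected D) : IsPreconnected (V \ D) := by
  have : Nontrivial E := Module.nontrivial_of_finrank_pos (R := ℝ) (by omega)
  refine nonsep_of_local hVc ?_ (td_compl_dense hDd)
  intro x hx
  obtain ⟨R, hR, hRV⟩ := Metric.isOpen_iff.1 hV x hx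
  refine ⟨R / 20, by positivity, (ball_subset_ball (by linarith)).trans hRV, ?_⟩
  intro p hp q hq
  have hO : IsOpen (V \ D) := hV.sdiff hD.isClosed
  have hpO : p ∈ V \ D := ⟨hRV (ball_subset_ball (by linarith) hp.1), hp.2⟩
  have hqO : q ∈ V \ D := ⟨hRV (ball_subset_ball (by linarith) hq.1), hq.2⟩
  set Q := connectedComponentIn (V \ D) p with hQ
  by_cases hqQ : q ∈ Q
  · exact ⟨Q, connectedComponentIn_subset _ _, isPreconnected_connectedComponentIn,
      mem_connectedComponentIn hpO, hqQ⟩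
  exfalso
  have hpQ : p ∈ Q := mem_connectedComponentIn hpO
  have hv0 : q - p ≠ 0 := fun h => hqQ (by rw [sub_eq_zero.1 h]; exact hpQ)
  obtain ⟨w, hw⟩ := exists_linearIndependent_pair_of_one_lt_finrank hE hv0
  have hwp := LinearIndependent.pair_iff.1 hw
  have hw0 : w ≠ 0 := fun h => by
    have := hwp 0 1 (by simp [h]); simp at this
  set c : ℝ := ‖q - p‖ / ‖w‖ with hc
  have hvn : 0 < ‖q - p‖ := norm_pos_iff.2 hv0
  have hwn : 0 < ‖w‖ := norm_pos_iff.2 hw0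
  have hc0 : 0 < c := by positivity
  set ι : ℂ → E := fun z => p + (z.re • (q - p) + (c * z.im) • w) with hι
  have hιc : Continuous ι := by
    have := Complex.continuous_re
    have := Complex.continuous_im
    fun_prop
  have hιi : Function.Injective ι := by
    intro a b hab
    have h1 : (a.re - b.re) • (q - p) + (c * a.im - c * b.im) • w = 0 := by
      have h2 := add_left_cancel hab
      rw [sub_smul, sub_smul, sub_add_sub_comm, h2, sub_self]
    obtain ⟨h3, h4⟩ := hwp _ _ h1
    apply Complex.ext
    · linarith
    · have : c * (a.im - b.im) = 0 := by linarith
      rcases mul_eq_zero.1 this with h | h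
      · exact absurd h hc0.ne'
      · linarith
  have hιV : ∀ z ∈ closedBall (0 : ℂ) 3, ι z ∈ V := by
    intro z hz
    apply hRV
    rw [mem_closedBall, dist_zero_right] at hz
    have hpx := hp.1
    have hqx := hq.1
    rw [mem_ball] at hpx hqx ⊢
    have hvb : ‖q - p‖ < R / 10 := by
      rw [← dist_eq_norm]
      linarith [dist_triangle_right q p x]
    have h1 : ‖ι z - p‖ ≤ 6 * ‖q - p‖ := by
      simp only [hι, add_sub_cancel_left]
      refine (norm_add_le _ _).trans ?_
      rw [norm_smul, norm_smul, norm_mul, Real.norm_of_nonneg hc0.le, Real.norm_eq_abs,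
        Real.norm_eq_abs]
      have e : c * ‖w‖ = ‖q - p‖ := by rw [hc, div_mul_cancel₀ _ hwn.ne']
      have e2 : c * |z.im| * ‖w‖ = |z.im| * ‖q - p‖ := by rw [← e]; ring
      rw [e2]
      have h5 := (Complex.abs_re_le_norm z).trans hz
      have h6 := (Complex.abs_im_le_norm z).trans hz
      nlinarith
    rw [← dist_eq_norm] at h1
    linarith [dist_triangle (ι z) p x]
  have hOQ : IsOpen ((V \ D) \ Q) := by
    rw [isOpen_iff_forall_mem_open]
    intro y hy
    refine ⟨connectedComponentIn (V \ D) y, ?_, hO.connectedComponentIn,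
      mem_connectedComponentIn hy.1⟩
    intro z hz
    refine ⟨connectedComponentIn_subset _ _ hz, fun hzQ => hy.2 ?_⟩
    rw [hQ, connectedComponentIn_eq hzQ, ← connectedComponentIn_eq hz]
    exact mem_connectedComponentIn hy.1
  refine planar_nonsep (ι ⁻¹' D ∩ closedBall 0 3) (ι ⁻¹' Q) (ι ⁻¹' ((V \ D) \ Q))
    ((isCompact_closedBall 0 3).inter_left (hD.isClosed.preimage hιc)) ?_
    (hO.connectedComponentIn.preimage hιc) (hOQ.preimage hιc) ?_ ?_ ?_ ?_ ?_ ?_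
  · intro t ht htc a ha b hb
    have : (ι '' t).Subsingleton := hDd _ (by
      rintro _ ⟨s, hs, rfl⟩; exact (ht hs).1) (htc.image _ hιc.continuousOn)
    exact hιi (this ⟨a, ha, rfl⟩ ⟨b, hb, rfl⟩)
  · exact Set.disjoint_left.2 fun z hz hz' => hz'.2 hz
  · intro z hz
    by_cases hzD : ι z ∈ D
    · exact Or.inr ⟨hzD, hz⟩
    · left
      by_cases hzQ : ι z ∈ Q
      · exact Or.inl hzQ
      · exact Or.inr ⟨⟨hιV z hz, hzD⟩, hzQ⟩
  · exact Set.disjoint_left.2 fun z hz hz' => (connectedComponentIn_subset _ _ hz).2 hz'.1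
  · exact Set.disjoint_left.2 fun z hz hz' => hz.1.2 hz'.1
  · simpa [hι] using hpQ
  · simpa [hι] using And.intro hqO hqQ

lemma avoid_finset {α X : Type*} [TopologicalSpace X] (L : Finset α) (S : α → Set X)
    (hS : ∀ l ∈ L, IsClosed (S l)) (hi : ∀ l ∈ L, interior (S l) = ∅) :
    ∀ O : Set X, IsOpen O → O.Nonempty → ∃ z ∈ O, ∀ l ∈ L, z ∉ S l := by
  classical
  induction L using Finset.induction_on with
  | empty => intro O _ ⟨z, hz⟩; exact ⟨z, hz, by simp⟩
  | insert a L ha ih =>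
    intro O hO hne
    have hne' : (O \ S a).Nonempty := by
      by_contra h
      rw [Set.not_nonempty_iff_eq_empty, Set.sdiff_eq_empty] at h
      have h2 := interior_maximal h hO
      rw [hi a (by simp)] at h2
      obtain ⟨z, hz⟩ := hne
      exact h2 hz
    obtain ⟨z, hz, h⟩ := ih (fun l hl => hS l (by simp [hl])) (fun l hl => hi l (by simp [hl]))
      (O \ S a) (hO.sdiff (hS a (by simp))) hne'
    refine ⟨z, hz.1, fun l hl => ?_⟩
    rcases Finset.mem_insert.1 hl with rfl | hl
    · exact hz.2
    · exact h l hl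

/-- The plane through `p` and the line `l`. -/
def planeThrough (p : E) (l : E × E) : Set E :=
  (fun z => z - p) ⁻¹' (Submodule.span ℝ {l.1 - p, l.2} : Set E)

lemma planeThrough_closed [FiniteDimensional ℝ E] (p : E) (l : E × E) :
    IsClosed (planeThrough p l) :=
  (Submodule.closed_of_finiteDimensional _).preimage (by fun_prop)

lemma planeThrough_interior [FiniteDimensional ℝ E] (hE : 2 < Module.finrank ℝ E)
    (p : E) (l : E × E) : interior (planeThrough p l) = ∅ := by
  classical
  by_contra h
  have hne : (interior (planeThrough p l)).Nonempty := Set.nonempty_iff_ne_empty.2 h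
  have he : planeThrough p l = (Homeomorph.subRight p) ⁻¹'
    (Submodule.span ℝ {l.1 - p, l.2} : Set E) := rfl
  rw [he, ← Homeomorph.preimage_interior] at hne
  obtain ⟨z, hz⟩ := hne
  have htop := Submodule.eq_top_of_nonempty_interior' _ ⟨_, hz⟩
  have h1 : Module.finrank ℝ (Submodule.span ℝ ({l.1 - p, l.2} : Set E)) ≤ 2 := by
    have := finrank_span_finset_le_card (R := ℝ) ({l.1 - p, l.2} : Finset E)
    simp only [Finset.coe_insert, Finset.coe_singleton] at this
    exact this.trans Finset.card_le_two
  rw [htop, finrank_top] at h1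
  omega

lemma planeThrough_seg {p z : E} {l : E × E} (hz : z ∉ planeThrough p l) {y : E}
    (hy : y ∈ segment ℝ p z) {t : ℝ} (hyl : y = l.1 + t • l.2) : y = p := by
  rw [segment_eq_image'] at hy
  obtain ⟨s, _, hs⟩ := hy
  by_cases h0 : s = 0
  · rw [← hs, h0]; simp
  exfalso
  apply hz
  have h1 : z - p = s⁻¹ • ((l.1 - p) + t • l.2) := by
    have : s • (z - p) = (l.1 - p) + t • l.2 := by
      have h2 : p + s • (z - p) = l.1 + t • l.2 := by rw [← hyl, ← hs]
      rw [sub_add_eq_add_sub, ← h2]; abel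
    rw [← this, smul_smul, inv_mul_cancel₀ h0, one_smul]
  change z - p ∈ Submodule.span ℝ {l.1 - p, l.2}
  rw [h1]
  refine Submodule.smul_mem _ _ (Submodule.add_mem _ (Submodule.subset_span (by simp))
    (Submodule.smul_mem _ _ (Submodule.subset_span (by simp))))

/-- `A` is contained in finitely many lines. -/
def InLines (A : Set E) : Prop :=
  ∃ L : Finset (E × E), ∀ x ∈ A, ∃ l ∈ L, ∃ t : ℝ, x = l.1 + t • l.2

lemma nonsep_lines [FiniteDimensional ℝ E] (hE : 2 < Module.finrank ℝ E)
    {V A : Set E} (hV : IsOpen V) (hVc : IsPreconnected V)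
    (hAL : InLines A) : IsPreconnected (V \ A) := by
  obtain ⟨L, hL⟩ := hAL
  refine nonsep_of_local hVc ?_ ?_
  · intro x hx
    obtain ⟨R, hR, hRV⟩ := Metric.isOpen_iff.1 hV x hx
    refine ⟨R, hR, hRV, ?_⟩
    intro p hp q hq
    obtain ⟨z, hz, hzL⟩ := avoid_finset L (fun l => planeThrough p l ∪ planeThrough q l)
      (fun l _ => (planeThrough_closed p l).union (planeThrough_closed q l))
      (fun l _ => by
        rw [interior_union_isClosed_of_interior_empty (planeThrough_closed p l)
          (planeThrough_interior hE q l), planeThrough_interior hE]) (ball x R) isOpen_ball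
      ⟨x, mem_ball_self hR⟩
    have key : ∀ p ∈ ball x R \ A, (∀ l ∈ L, z ∉ planeThrough p l) → segment ℝ p z ⊆ V \ A := by
      intro p hp hpl y hy
      refine ⟨hRV ((convex_ball x R).segment_subset hp.1 hz hy), fun hyA => ?_⟩
      obtain ⟨l, hl, t, ht⟩ := hL y hyA
      have := planeThrough_seg (hpl l hl) hy ht
      exact hp.2 (this ▸ hyA)
    refine ⟨segment ℝ p z ∪ segment ℝ q z, Set.union_subset
      (key p hp fun l hl h => hzL l hl (Or.inl h)) (key q hq fun l hl h => hzL l hl (Or.inr h)),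
      ?_, Or.inl (left_mem_segment _ _ _), Or.inr (left_mem_segment _ _ _)⟩
    exact IsPreconnected.union z (right_mem_segment _ _ _) (right_mem_segment _ _ _)
      (convex_segment _ _).isPreconnected (convex_segment _ _).isPreconnected
  · intro O hO ⟨p, hp⟩
    obtain ⟨z, hz, hzL⟩ := avoid_finset L (fun l => planeThrough p l)
      (fun l _ => planeThrough_closed p l) (fun l _ => planeThrough_interior hE p l) O hO ⟨p, hp⟩
    refine ⟨z, hz, fun hzA => ?_⟩
    obtain ⟨l, hl, t, ht⟩ := hL z hzA
    apply hzL l hl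
    change z - p ∈ Submodule.span ℝ {l.1 - p, l.2}
    have : z - p = (l.1 - p) + t • l.2 := by rw [ht]; abel
    rw [this]
    exact (Submodule.add_mem _ (Submodule.subset_span (by simp))
      (Submodule.smul_mem _ _ (Submodule.subset_span (by simp))))

lemma InLines.union {A B : Set E} (hA : InLines A) (hB : InLines B) : InLines (A ∪ B) := by
  classical
  obtain ⟨L, hL⟩ := hA
  obtain ⟨M, hM⟩ := hB
  refine ⟨L ∪ M, ?_⟩
  rintro x (hx | hx)
  · obtain ⟨l, hl, h⟩ := hL x hx
    exact ⟨l, by simp [hl], h⟩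
  · obtain ⟨l, hl, h⟩ := hM x hx
    exact ⟨l, by simp [hl], h⟩

lemma inLines_segment (p q : E) : InLines (segment ℝ p q) := by
  refine ⟨{(p, q - p)}, ?_⟩
  intro x hx
  rw [segment_eq_image'] at hx
  obtain ⟨s, _, rfl⟩ := hx
  exact ⟨_, Finset.mem_singleton_self _, s, rfl⟩

lemma isCompact_segment' (p q : E) : IsCompact (segment ℝ p q) := by
  rw [segment_eq_image']
  exact isCompact_Icc.image (by fun_prop)

lemma exists_poly {O : Set E} (hO : IsOpen O) (hOc : IsPreconnected O) {p q : E}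
    (hp : p ∈ O) (hq : q ∈ O) :
    ∃ A ⊆ O, IsCompact A ∧ IsPreconnected A ∧ InLines A ∧ p ∈ A ∧ q ∈ A := by
  refine hOc.induction₂ (fun p q => ∃ A ⊆ O, IsCompact A ∧ IsPreconnected A ∧ InLines A ∧
    p ∈ A ∧ q ∈ A) ?_ ?_ ?_ hp hq
  · intro x hx
    obtain ⟨R, hR, hRV⟩ := Metric.isOpen_iff.1 hO x hx
    filter_upwards [mem_nhdsWithin_of_mem_nhds (ball_mem_nhds x hR)] with y hy
    exact ⟨segment ℝ x y, ((convex_ball x R).segment_subset (mem_ball_self hR) hy).trans hRV,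
      isCompact_segment' x y, (convex_segment _ _).isPreconnected, inLines_segment x y,
      left_mem_segment _ _ _, right_mem_segment _ _ _⟩
  · rintro x y z _ _ _ ⟨A, hA, hAc, hAp, hAl, hx, hy⟩ ⟨B, hB, hBc, hBp, hBl, hy', hz⟩
    exact ⟨A ∪ B, Set.union_subset hA hB, hAc.union hBc, hAp.union y hy hy' hBp, hAl.union hBl,
      Or.inl hx, Or.inr hz⟩
  · rintro x y _ _ ⟨A, hA, hAc, hAp, hAl, hx, hy⟩
    exact ⟨A, hA, hAc, hAp, hAl, hy, hx⟩

lemma exists_poly_finset {O : Set E} (hO : IsOpen O) (hOc : IsPreconnected O) {p : E}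
    (hp : p ∈ O) (s : Finset E) (hs : ∀ q ∈ s, q ∈ O) :
    ∃ A ⊆ O, IsCompact A ∧ IsPreconnected A ∧ InLines A ∧ p ∈ A ∧ ∀ q ∈ s, q ∈ A := by
  classical
  induction s using Finset.induction_on with
  | empty =>
    obtain ⟨A, h1, h2, h3, h4, h5, _⟩ := exists_poly hO hOc hp hp
    exact ⟨A, h1, h2, h3, h4, h5, by simp⟩
  | insert a s ha ih =>
    obtain ⟨A, h1, h2, h3, h4, h5, h6⟩ := ih fun q hq => hs q (by simp [hq])
    obtain ⟨B, k1, k2, k3, k4, k5, k6⟩ := exists_poly hO hOc hp (hs a (by simp))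
    refine ⟨A ∪ B, Set.union_subset h1 k1, h2.union k2, h3.union p h5 k5 k3, h4.union k4,
      Or.inl h5, fun q hq => ?_⟩
    rcases Finset.mem_insert.1 hq with rfl | hq
    · exact Or.inr k6
    · exact Or.inl (h6 q hq)

lemma exists_compact_connected [FiniteDimensional ℝ E] {U K : Set E} (hU : IsOpen U)
    (hUc : IsPreconnected U) {p : E} (hp : p ∈ U) (hK : IsCompact K) (hKU : K ⊆ U) :
    ∃ L ⊆ U, IsCompact L ∧ IsPreconnected L ∧ p ∈ L ∧ K ⊆ L := by
  refine hK.induction_on (p := fun s => ∃ L ⊆ U, IsCompact L ∧ IsPreconnected L ∧ p ∈ L ∧ s ⊆ L)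
    ?_ ?_ ?_ ?_
  · exact ⟨{p}, by simpa using hp, isCompact_singleton, isPreconnected_singleton, rfl, by simp⟩
  · rintro s t hst ⟨L, h1, h2, h3, h4, h5⟩
    exact ⟨L, h1, h2, h3, h4, hst.trans h5⟩
  · rintro s t ⟨L, h1, h2, h3, h4, h5⟩ ⟨M, k1, k2, k3, k4, k5⟩
    exact ⟨L ∪ M, Set.union_subset h1 k1, h2.union k2, h3.union p h4 k4 k3, Or.inl h4,
      Set.union_subset_union h5 k5⟩
  · intro x hx
    obtain ⟨R, hR, hRV⟩ := Metric.nhds_basis_closedBall.mem_iff.1 (hU.mem_nhds (hKU hx))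
    obtain ⟨A, h1, h2, h3, h4, h5, h6⟩ := exists_poly hU hUc hp (hKU hx)
    refine ⟨closedBall x R, mem_nhdsWithin_of_mem_nhds (closedBall_mem_nhds x hR),
      A ∪ closedBall x R, Set.union_subset h1 hRV, h2.union (isCompact_closedBall x R),
      h3.union x h6 (mem_closedBall_self hR.le) (convex_closedBall x R).isPreconnected,
      Or.inl h5, Set.subset_union_right⟩

/-! ### Homogeneity -/

lemma exists_push [FiniteDimensional ℝ E] [Nontrivial E] (c v : E) (r : ℝ) (hv : ‖v‖ < r) :
    ∃ h : E ≃ₜ E, (∀ x ∉ ball c r, h x = x) ∧ h c = c + v := by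
  have hr : 0 < r := (norm_nonneg v).trans_lt hv
  set f : E → E := fun x => x + (max 0 (r - ‖x - c‖) / r) • v with hf
  have hk : ‖v‖ / r < 1 := (div_lt_one hr).2 hv
  set k : NNReal := ⟨‖v‖ / r, by positivity⟩ with hkd
  have happ : ApproximatesLinearOn f ((ContinuousLinearEquiv.refl ℝ E : E ≃L[ℝ] E) : E →L[ℝ] E)
      Set.univ k := by
    intro x _ y _
    have e : f x - f y - ((ContinuousLinearEquiv.refl ℝ E : E ≃L[ℝ] E) : E →L[ℝ] E) (x - y)
        = ((max 0 (r - ‖x - c‖) - max 0 (r - ‖y - c‖)) / r) • v := by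
      simp only [hf, ContinuousLinearEquiv.coe_refl, ContinuousLinearMap.id_apply, sub_div, sub_smul]
      abel
    rw [e, norm_smul, norm_div, Real.norm_of_nonneg hr.le]
    have h1 : ‖max 0 (r - ‖x - c‖) - max 0 (r - ‖y - c‖)‖ ≤ ‖x - y‖ := by
      rw [Real.norm_eq_abs]
      have h2 := abs_max_sub_max_le_abs (r - ‖x - c‖) (r - ‖y - c‖) 0
      rw [max_comm 0, max_comm 0]
      refine h2.trans ?_
      have h3 := abs_norm_sub_norm_le (y - c) (x - c)
      rw [sub_sub_sub_cancel_right] at h3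
      rw [sub_sub_sub_cancel_left, norm_sub_rev x y]
      exact h3
    change _ ≤ ‖v‖ / r * ‖x - y‖
    rw [div_mul_eq_mul_div, div_mul_eq_mul_div, mul_comm ‖v‖]
    gcongr
  have hN : k < ‖((ContinuousLinearEquiv.refl ℝ E : E ≃L[ℝ] E).symm : E →L[ℝ] E)‖₊⁻¹ := by
    have : ‖((ContinuousLinearEquiv.refl ℝ E : E ≃L[ℝ] E).symm : E →L[ℝ] E)‖₊ = 1 := by
      simp
    rw [this, inv_one]
    exact hk
  refine ⟨happ.toHomeomorph f (Or.inr hN), ?_, ?_⟩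
  · intro x hx
    change f x = x
    have : r - ‖x - c‖ ≤ 0 := by
      rw [mem_ball, dist_eq_norm] at hx; linarith
    simp [hf, max_eq_left this]
  · change f c = c + v
    simp [hf, max_eq_right hr.le, div_self hr.ne']

lemma homeo_symm_id {N : Set E} {h : E ≃ₜ E} (hh : ∀ x ∉ N, h x = x) : ∀ x ∉ N, h.symm x = x := by
  intro x hx
  rw [Homeomorph.symm_apply_eq, hh x hx]

lemma homeo_mem {N : Set E} {h : E ≃ₜ E} (hh : ∀ x ∉ N, h x = x) {x : E} (hx : x ∈ N) :
    h x ∈ N := by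
  by_contra hn
  have := hh _ hn
  exact hn (by rw [h.injective this]; exact hx)

lemma homogeneity [FiniteDimensional ℝ E] [Nontrivial E] {N : Set E} (hN : IsOpen N)
    (hNc : IsPreconnected N) {p q : E} (hp : p ∈ N) (hq : q ∈ N) :
    ∃ h : E ≃ₜ E, (∀ x ∉ N, h x = x) ∧ h p = q := by
  refine hNc.induction₂ (fun p q => ∃ h : E ≃ₜ E, (∀ x ∉ N, h x = x) ∧ h p = q) ?_ ?_ ?_ hp hq
  · intro x hx
    obtain ⟨R, hR, hRV⟩ := Metric.isOpen_iff.1 hN x hx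
    filter_upwards [mem_nhdsWithin_of_mem_nhds (ball_mem_nhds x hR)] with y hy
    obtain ⟨h, h1, h2⟩ := exists_push x (y - x) R (by rwa [mem_ball, dist_eq_norm] at hy)
    exact ⟨h, fun z hz => h1 z fun hz' => hz (hRV hz'), by rw [h2]; abel⟩
  · rintro x y z _ _ _ ⟨h, h1, h2⟩ ⟨k, k1, k2⟩
    exact ⟨h.trans k, fun w hw => by simp [h1 w hw, k1 w hw], by simp [h2, k2]⟩
  · rintro x y _ _ ⟨h, h1, h2⟩
    exact ⟨h.symm, homeo_symm_id h1, by rw [← h2]; simp⟩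

/-- Move an infinite set so as to meet finitely many open sets. -/
lemma multi_move [FiniteDimensional ℝ E] (hE : 1 < Module.finrank ℝ E)
    {N : Set E} (hN : IsOpen N) (hNc : IsPreconnected N) {P : Set E}
    (hP : (P ∩ N).Infinite) {α : Type*} (s : Finset α) (G : α → Set E)
    (hG : ∀ a ∈ s, IsOpen (G a)) (hGN : ∀ a ∈ s, (G a ∩ N).Nonempty) :
    ∃ h : E ≃ₜ E, (∀ x ∉ N, h x = x) ∧ ∀ a ∈ s, ∃ y ∈ P, h y ∈ G a := by
  classical
  have : Nontrivial E := Module.nontrivial_of_finrank_pos (R := ℝ) (by omega)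
  induction s using Finset.induction_on with
  | empty => exact ⟨Homeomorph.refl E, by simp, by simp⟩
  | insert a s ha ih =>
    obtain ⟨h, h1, h2⟩ := ih (fun b hb => hG b (by simp [hb])) (fun b hb => hGN b (by simp [hb]))
    choose! y hyP hyG using h2
    set Y : Set E := ↑(s.image fun b => h (y b)) with hY
    have hYf : Y.Finite := Finset.finite_toSet _
    have hinf : ((h '' (P ∩ N)) \ Y).Infinite :=
      (hP.image h.injective.injOn).sdiff hYf
    obtain ⟨x, ⟨⟨w, hw, rfl⟩, hxY⟩⟩ := hinf.nonempty
    have hYtd : IsTotallyDisconnected Y := hYf.countable.isTotallyDisconnected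
    obtain ⟨q, hq, hqY⟩ := td_compl_dense hYtd (G a ∩ N) ((hG a (by simp)).inter hN)
      (hGN a (by simp))
    obtain ⟨g, g1, g2⟩ := homogeneity (hN.sdiff hYf.isClosed)
      (nonsep_td hE hN hNc hYf.isCompact hYtd) (p := h w) (q := q)
      ⟨homeo_mem h1 hw.2, hxY⟩ ⟨hq.2, hqY⟩
    refine ⟨h.trans g, fun z hz => ?_, fun b hb => ?_⟩
    · simp only [Homeomorph.trans_apply]
      rw [h1 z hz, g1 z (fun hz' => hz hz'.1)]
    · rcases Finset.mem_insert.1 hb with rfl | hb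
      · exact ⟨w, hw.1, by simp only [Homeomorph.trans_apply]; rw [g2]; exact hq.1⟩
      · refine ⟨y b, hyP b hb, ?_⟩
        simp only [Homeomorph.trans_apply]
        rw [g1]
        · exact hyG b hb
        · intro hz
          exact hz.2 (Finset.mem_coe.2 (Finset.mem_image_of_mem _ hb))

end PartTwo

/-! ### Part 3: the inductive step -/

section PartThree

variable {E : Type*} [NormedAddCommGroup E] [NormedSpace ℝ E]

lemma small_comp {D : Set E} (hD : IsCompact D) (hDd : IsTotallyDisconnected D) {ε : ℝ}
    (hε : 0 < ε) : ∃ δ > 0, ∀ d ∈ D, ∀ T : Set E, IsPreconnected T → d ∈ T →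
      T ⊆ thickening δ D → ∀ t ∈ T, dist t d < ε := by
  have : CompactSpace D := isCompact_iff_compactSpace.1 hD
  have : TotallyDisconnectedSpace D := totallyDisconnectedSpace_subtype_iff.2 hDd
  refine hD.induction_on (p := fun s => ∃ δ > 0, ∀ d ∈ s, ∀ T : Set E, IsPreconnected T → d ∈ T →
      T ⊆ thickening δ D → ∀ t ∈ T, dist t d < ε) ?_ ?_ ?_ ?_
  · exact ⟨1, one_pos, by simp⟩
  · rintro s t hst ⟨δ, hδ, h⟩
    exact ⟨δ, hδ, fun d hd => h d (hst hd)⟩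
  · rintro s t ⟨δ, hδ, h⟩ ⟨δ', hδ', h'⟩
    refine ⟨min δ δ', lt_min hδ hδ', ?_⟩
    rintro d (hd | hd) T hT hdT hTD
    · exact h d hd T hT hdT (hTD.trans (thickening_mono (min_le_left _ _) _))
    · exact h' d hd T hT hdT (hTD.trans (thickening_mono (min_le_right _ _) _))
  · intro d0 hd0
    obtain ⟨K, hK, hd0K, hKb⟩ := compact_exists_isClopen_in_isOpen
      (X := D) (x := ⟨d0, hd0⟩) (U := Subtype.val ⁻¹' ball d0 (ε / 4))
      (isOpen_ball.preimage continuous_subtype_val) (by simpa using hε)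
    have hc1 : IsCompact (Subtype.val '' K : Set E) :=
      hK.isClosed.isCompact.image continuous_subtype_val
    have hc2 : IsCompact (Subtype.val '' Kᶜ : Set E) :=
      hK.compl.isClosed.isCompact.image continuous_subtype_val
    have hdis : Disjoint (Subtype.val '' K : Set E) (Subtype.val '' Kᶜ : Set E) :=
      (Set.disjoint_image_iff Subtype.val_injective).2 disjoint_compl_right
    obtain ⟨δ, hδ, hth⟩ := hdis.exists_thickenings hc1 hc2.isClosed
    refine ⟨Subtype.val '' K, ?_, min δ (ε / 4), lt_min hδ (by positivity), ?_⟩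
    · obtain ⟨O, hO, hOK⟩ := isOpen_induced_iff.1 hK.isOpen
      refine mem_nhdsWithin.2 ⟨O, hO, ?_, ?_⟩
      · have : (⟨d0, hd0⟩ : D) ∈ Subtype.val ⁻¹' O := by rw [hOK]; exact hd0K
        exact this
      · rintro y ⟨hyO, hyD⟩
        refine ⟨⟨y, hyD⟩, ?_, rfl⟩
        rw [← hOK]; exact hyO
    · rintro d hd T hT hdT hTD t ht
      have hDu : D = Subtype.val '' K ∪ Subtype.val '' Kᶜ := by
        rw [← Set.image_union, Set.union_compl_self, Set.image_univ, Subtype.range_coe]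
      have hsub : T ⊆ thickening δ (Subtype.val '' K) ∪ thickening δ (Subtype.val '' Kᶜ) := by
        rw [← thickening_union, ← hDu]
        exact hTD.trans (thickening_mono (min_le_left _ _) _)
      have hT1 : T ⊆ thickening δ (Subtype.val '' K) :=
        hT.subset_left_of_subset_union isOpen_thickening isOpen_thickening hth hsub
          ⟨d, hdT, self_subset_thickening hδ _ hd⟩
      -- use smaller thickening
      obtain ⟨e, he, hte⟩ := mem_thickening_iff.1 (hTD ht)
      have heK : e ∈ (Subtype.val '' K : Set E) := by
        rw [hDu] at he
        rcases he with he | he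
        · exact he
        · exfalso
          exact hth.le_bot ⟨hT1 ht, mem_thickening_iff.2 ⟨e, he, hte.trans_le (min_le_left _ _)⟩⟩
      obtain ⟨e', he', rfl⟩ := heK
      obtain ⟨d', hd', rfl⟩ := hd
      have h1 : dist (e' : E) d0 < ε / 4 := hKb he'
      have h2 : dist (d' : E) d0 < ε / 4 := hKb hd'
      have h3 : dist t e' < ε / 4 := hte.trans_le (min_le_right _ _)
      have := dist_triangle t e' d'
      have := dist_triangle_right (e' : E) d' d0
      linarith

lemma small_nbhds {D W : Set E} (hD : IsCompact D) (hDd : IsTotallyDisconnected D)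
    (hW : IsOpen W) (hDW : D ⊆ W) {ε : ℝ} (hε : 0 < ε) :
    ∃ U : Set (Set E), U.Finite ∧ (∀ u ∈ U, IsOpen u ∧ IsPreconnected u ∧ (u ∩ D).Nonempty ∧
      u ⊆ W ∧ ∀ a ∈ u, ∀ b ∈ u, dist a b ≤ ε) ∧ U.PairwiseDisjoint id ∧ D ⊆ ⋃₀ U := by
  obtain ⟨δ, hδ, h⟩ := small_comp hD hDd (half_pos hε)
  set O := thickening δ D ∩ W with hOd
  have hO : IsOpen O := isOpen_thickening.inter hW
  have hDO : D ⊆ O := fun d hd => ⟨self_subset_thickening hδ _ hd, hDW hd⟩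
  refine ⟨connectedComponentIn O '' D, ?_, ?_, ?_, ?_⟩
  · refine hD.induction_on (p := fun s => (connectedComponentIn O '' s).Finite) (by simp) ?_ ?_ ?_
    · intro s t hst ht; exact ht.subset (Set.image_mono hst)
    · intro s t hs ht
      rw [Set.image_union]; exact hs.union ht
    · intro d hd
      refine ⟨connectedComponentIn O d, mem_nhdsWithin_of_mem_nhds
        (hO.connectedComponentIn.mem_nhds (mem_connectedComponentIn (hDO hd))), ?_⟩
      refine (Set.finite_singleton (connectedComponentIn O d)).subset ?_
      rintro _ ⟨y, hy, rfl⟩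
      exact (connectedComponentIn_eq hy).symm
  · rintro _ ⟨d, hd, rfl⟩
    refine ⟨hO.connectedComponentIn, isPreconnected_connectedComponentIn,
      ⟨d, mem_connectedComponentIn (hDO hd), hd⟩,
      (connectedComponentIn_subset _ _).trans Set.inter_subset_right, ?_⟩
    have key : ∀ a ∈ connectedComponentIn O d, dist a d < ε / 2 :=
      h d hd _ isPreconnected_connectedComponentIn (mem_connectedComponentIn (hDO hd))
        ((connectedComponentIn_subset _ _).trans Set.inter_subset_left)
    intro a ha b hb
    linarith [key a ha, key b hb, dist_triangle_right a b d]
  · rintro _ ⟨d, hd, rfl⟩ _ ⟨e, he, rfl⟩ hne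
    refine Set.disjoint_left.2 fun y hy hy' => hne ?_
    rw [connectedComponentIn_eq hy, ← connectedComponentIn_eq hy']
  · intro d hd
    exact ⟨_, ⟨d, hd, rfl⟩, mem_connectedComponentIn (hDO hd)⟩

variable {X : Type*} [MetricSpace X] [CompactSpace X]

lemma tip [FiniteDimensional ℝ E] {U L : Set E} (hU : IsOpen U) (hUc : IsPreconnected U)
    (hLU : L ⊆ U) (hL : IsCompact L)
    (hLc : IsPreconnected L) {l : E} (hl : l ∈ L) {g : X → E} (hg : Continuous g)
    (hgi : Function.Injective g) (hLg : ∀ x, g x ∉ L) {x1 : X} (hx1 : g x1 ∈ U) {ε : ℝ}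
    (hε : 0 < ε) :
    ∃ W : Set E, IsOpen W ∧ IsPreconnected W ∧ L ⊆ W ∧ closure W ⊆ U ∧ (∃ x, g x ∈ W) ∧
      ∀ x y, g x ∈ W → g y ∈ W → dist x y ≤ ε := by
  have hconn : IsConnected U := ⟨⟨l, hLU hl⟩, hUc⟩
  have hpc : IsPathConnected U := hU.isConnected_iff_isPathConnected.1 hconn
  obtain ⟨γ, hγ⟩ := hpc.joinedIn l (hLU hl) (g x1) hx1
  have hrc : IsClosed (Set.range g) := (isCompact_range hg).isClosed
  have hSc : IsCompact (γ ⁻¹' Set.range g) := (hrc.preimage γ.continuous).isCompact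
  obtain ⟨t, ht, htmin⟩ := hSc.exists_isLeast ⟨1, by simp⟩
  obtain ⟨x', hx'⟩ := ht
  set Λ := L ∪ γ '' Set.Iic t with hΛ
  have hΛc : IsCompact Λ := hL.union (isClosed_Iic.isCompact.image γ.continuous)
  have hΛp : IsPreconnected Λ := hLc.union l hl
    ⟨0, unitInterval.nonneg', γ.source⟩ (isPreconnected_Iic.image _ γ.continuous.continuousOn)
  have hbad : IsCompact (g '' (ball x' (ε / 2))ᶜ) :=
    (isOpen_ball.isClosed_compl.isCompact).image hg
  have hΛO : Λ ⊆ U \ g '' (ball x' (ε / 2))ᶜ := by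
    rintro y (hy | ⟨s, hs, rfl⟩)
    · refine ⟨hLU hy, ?_⟩
      rintro ⟨x, _, rfl⟩
      exact hLg x hy
    · refine ⟨hγ s, ?_⟩
      rintro ⟨x, hx, hxs⟩
      have h1 : t ≤ s := htmin ⟨x, hxs⟩
      have h2 : s = t := le_antisymm hs h1
      rw [h2, ← hx'] at hxs
      rw [hgi hxs] at hx
      exact hx (mem_ball_self (by positivity))
  obtain ⟨O, hO, hΛO', hOcl, _⟩ := exists_open_between_and_isCompact_closure hΛc
    (hU.sdiff hbad.isClosed) hΛO
  have hsub : Λ ⊆ connectedComponentIn O l := hΛp.subset_connectedComponentIn (Or.inl hl) hΛO'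
  have hcl : closure (connectedComponentIn O l) ⊆ U \ g '' (ball x' (ε / 2))ᶜ :=
    (closure_mono (connectedComponentIn_subset _ _)).trans hOcl
  refine ⟨connectedComponentIn O l, hO.connectedComponentIn, isPreconnected_connectedComponentIn,
    Set.subset_union_left.trans hsub, hcl.trans Set.sdiff_subset,
    ⟨x', ?_⟩, ?_⟩
  · rw [hx']
    exact hsub (Or.inr ⟨t, Set.mem_Iic.2 le_rfl, rfl⟩)
  · have key : ∀ x, g x ∈ connectedComponentIn O l → dist x x' < ε / 2 := by
      intro x hx
      by_contra hn
      exact (hcl (subset_closure hx)).2 ⟨x, hn, rfl⟩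
    intro x y hx hy
    linarith [key x hx, key y hy, dist_triangle_right x y x']

/-- Properties of a new finite family of neighbourhoods. -/
structure GoodFam (g : X → E) (D : Set E) (ε : ℝ) (W : Set (Set E)) : Prop where
  fin : W.Finite
  isOpen : ∀ w ∈ W, IsOpen w
  conn : ∀ w ∈ W, IsPreconnected w
  meets : ∀ w ∈ W, ∃ x, g x ∈ w
  small : ∀ w ∈ W, ∀ a ∈ w, ∀ b ∈ w, dist a b ≤ ε
  small' : ∀ w ∈ W, ∀ x y, g x ∈ w → g y ∈ w → dist x y ≤ ε
  disj : W.PairwiseDisjoint id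
  cover : D ⊆ ⋃₀ W
  avoid : ∀ x, g x ∉ D

lemma one_step [FiniteDimensional ℝ E] (hE : 2 < Module.finrank ℝ E)
    (hX : ∀ O : Set X, IsOpen O → O.Nonempty → O.Infinite)
    {f : X → E} (hf : Continuous f) (hfi : Function.Injective f)
    {V D : Set E} (hV : IsOpen V) (hVc : IsPreconnected V) (hD : IsCompact D)
    (hDd : IsTotallyDisconnected D) (hDV : D ⊆ V) (hfD : ∀ x, f x ∉ D) {x0 : X} (hx0 : f x0 ∈ V)
    {ε : ℝ} (hε : 0 < ε) :
    ∃ h : E ≃ₜ E, (∀ x ∉ V, h x = x) ∧ ∃ W : Set (Set E),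
      GoodFam (fun x => h (f x)) D ε W ∧ ∀ w ∈ W, closure w ⊆ V := by
  classical
  have hnt : Nontrivial E := Module.nontrivial_of_finrank_pos (R := ℝ) (by omega)
  have hrc : IsClosed (Set.range f) := (isCompact_range hf).isClosed
  obtain ⟨U, hUf, hU, hUd, hDU⟩ := small_nbhds hD hDd (hV.sdiff hrc)
    (fun d hd => ⟨hDV hd, by rintro ⟨x, rfl⟩; exact hfD x hd⟩) hε
  -- the polygonal tree
  have hq : ∀ u ∈ U, (u \ D).Nonempty := fun u hu =>
    td_compl_dense hDd u (hU u hu).1 ((hU u hu).2.2.1.mono Set.inter_subset_left)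
  choose! q hq using hq
  obtain ⟨A, hAV, hAc, hAp, hAl, hxA, hqA⟩ := exists_poly_finset (hV.sdiff hD.isClosed)
    (nonsep_td (by omega) hV hVc hD hDd) (p := f x0) ⟨hx0, hfD x0⟩ (hUf.toFinset.image q) (by
      intro y hy
      obtain ⟨u, hu, rfl⟩ := Finset.mem_image.1 hy
      have hu := hUf.mem_toFinset.1 hu
      exact ⟨((hU u hu).2.2.2.1 (hq u hu).1).1, (hq u hu).2⟩)
  have hqA : ∀ u ∈ U, q u ∈ A := fun u hu =>
    hqA _ (Finset.mem_image_of_mem q (hUf.mem_toFinset.2 hu))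
  -- the connected compact sets
  have hL : ∀ u ∈ U, ∃ L ⊆ u \ A, IsCompact L ∧ IsPreconnected L ∧ L.Nonempty ∧ D ∩ u ⊆ L := by
    intro u hu
    obtain ⟨ho, hc, ⟨d, hdu, hdD⟩, _, _⟩ := hU u hu
    have hDA : ∀ y ∈ D, y ∉ A := fun y hy hyA => (hAV hyA).2 hy
    have hcomp : IsCompact (D ∩ u) := by
      have : D ∩ u = D \ ⋃₀ (U \ {u}) := by
        ext y
        constructor
        · rintro ⟨hy, hyu⟩
          refine ⟨hy, ?_⟩
          rintro ⟨v, ⟨hv, hvu⟩, hyv⟩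
          exact (hUd hv hu hvu).le_bot ⟨hyv, hyu⟩
        · rintro ⟨hy, hyn⟩
          refine ⟨hy, ?_⟩
          obtain ⟨v, hv, hyv⟩ := hDU hy
          by_cases e : v = u
          · exact e ▸ hyv
          · exact absurd ⟨v, ⟨hv, e⟩, hyv⟩ hyn
      rw [this]
      exact hD.diff (isOpen_sUnion fun v hv => (hU v hv.1).1)
    obtain ⟨L, h1, h2, h3, h4, h5⟩ := exists_compact_connected (ho.sdiff hAc.isClosed)
      (nonsep_lines hE ho hc hAl) (p := d) ⟨hdu, hDA d hdD⟩ hcomp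
      (fun y hy => ⟨hy.2, hDA y hy.1⟩)
    exact ⟨L, h1, h2, h3, ⟨d, h4⟩, h5⟩
  choose! L hLsub hLc hLp hLne hLD using hL
  set LL := ⋃ u ∈ U, L u with hLL
  have hLLc : IsCompact LL := hUf.isCompact_biUnion hLc
  have hALL : A ⊆ V \ LL := by
    intro y hy
    refine ⟨(hAV hy).1, fun hyL => ?_⟩
    obtain ⟨u, hu, hyu⟩ := Set.mem_iUnion₂.1 hyL
    exact (hLsub u hu hyu).2 hy
  have hfLL : ∀ x, f x ∉ LL := by
    intro x hx
    obtain ⟨u, hu, hyu⟩ := Set.mem_iUnion₂.1 hx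
    exact ((hU u hu).2.2.2.1 (hLsub u hu hyu).1).2 ⟨x, rfl⟩
  set N := connectedComponentIn (V \ LL) (f x0) with hN
  have hNo : IsOpen N := (hV.sdiff hLLc.isClosed).connectedComponentIn
  have hAN : A ⊆ N := hAp.subset_connectedComponentIn hxA hALL
  have hNsub : N ⊆ V \ LL := connectedComponentIn_subset _ _
  have hinf : (Set.range f ∩ N).Infinite := by
    have h1 : (f ⁻¹' N).Infinite := hX _ (hNo.preimage hf) ⟨x0, hAN hxA⟩
    have h2 := h1.image hfi.injOn
    refine h2.mono ?_
    rintro _ ⟨x, hx, rfl⟩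
    exact ⟨⟨x, rfl⟩, hx⟩
  obtain ⟨h, hid, hmeet⟩ := multi_move (by omega) hNo isPreconnected_connectedComponentIn hinf
    hUf.toFinset (fun u => u) (fun u hu => (hU u (hUf.mem_toFinset.1 hu)).1)
    (fun u hu => ⟨q u, (hq u (hUf.mem_toFinset.1 hu)).1, hAN (hqA u (hUf.mem_toFinset.1 hu))⟩)
  have hgLL : ∀ x, h (f x) ∉ LL := by
    intro x hx
    by_cases hxN : f x ∈ N
    · exact (hNsub (homeo_mem hid hxN)).2 hx
    · rw [hid _ hxN] at hx
      exact hfLL x hx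
  have hgc : Continuous fun x => h (f x) := h.continuous.comp hf
  have hgi : Function.Injective fun x => h (f x) := h.injective.comp hfi
  have hW : ∀ u ∈ U, ∃ W : Set E, IsOpen W ∧ IsPreconnected W ∧ L u ⊆ W ∧ closure W ⊆ u ∧
      (∃ x, h (f x) ∈ W) ∧ ∀ x y, h (f x) ∈ W → h (f y) ∈ W → dist x y ≤ ε := by
    intro u hu
    obtain ⟨_, ⟨x1, rfl⟩, hx1⟩ := hmeet u (hUf.mem_toFinset.2 hu)
    obtain ⟨l, hl⟩ := hLne u hu
    exact tip (hU u hu).1 (hU u hu).2.1 ((hLsub u hu).trans Set.sdiff_subset) (hLc u hu) (hLp u hu)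
      hl hgc hgi (fun x hx => hgLL x (Set.mem_biUnion hu hx)) (x1 := x1) hx1 hε
  choose! W hWo hWp hLW hWcl hWm hWs using hW
  refine ⟨h, fun x hx => hid x fun hxN => hx (hNsub hxN).1, W '' U, ⟨hUf.image W, ?_, ?_, ?_, ?_,
    ?_, ?_, ?_, ?_⟩, ?_⟩
  · rintro _ ⟨u, hu, rfl⟩; exact hWo u hu
  · rintro _ ⟨u, hu, rfl⟩; exact hWp u hu
  · rintro _ ⟨u, hu, rfl⟩; exact hWm u hu
  · rintro _ ⟨u, hu, rfl⟩ a ha b hb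
    exact (hU u hu).2.2.2.2 a (hWcl u hu (subset_closure ha)) b (hWcl u hu (subset_closure hb))
  · rintro _ ⟨u, hu, rfl⟩; exact hWs u hu
  · rintro _ ⟨u, hu, rfl⟩ _ ⟨v, hv, rfl⟩ hne
    have huv : u ≠ v := fun e => hne (by rw [e])
    exact (hUd hu hv huv).mono (subset_closure.trans (hWcl u hu))
      (subset_closure.trans (hWcl v hv))
  · intro d hd
    obtain ⟨u, hu, hdu⟩ := hDU hd
    exact ⟨W u, ⟨u, hu, rfl⟩, hLW u hu (hLD u hu ⟨hd, hdu⟩)⟩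
  · intro x hx
    obtain ⟨u, hu, hdu⟩ := hDU hx
    exact hgLL x (Set.mem_biUnion hu (hLD u hu ⟨hx, hdu⟩))
  · rintro _ ⟨u, hu, rfl⟩
    exact (hWcl u hu).trans ((hU u hu).2.2.2.1.trans Set.sdiff_subset)

lemma glue {𝒱 : Set (Set E)} (hfin : 𝒱.Finite) (hd : 𝒱.PairwiseDisjoint id)
    (h : Set E → E ≃ₜ E) (hh : ∀ V ∈ 𝒱, ∀ x ∉ V, h V x = x) :
    ∃ k : E ≃ₜ E, (∀ V ∈ 𝒱, ∀ x ∈ V, k x = h V x) ∧ ∀ x, (∀ V ∈ 𝒱, x ∉ V) → k x = x := by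
  induction 𝒱, hfin using Set.Finite.induction_on with
  | empty => exact ⟨Homeomorph.refl E, by simp, by simp⟩
  | @insert V 𝒱 hV hfin ih =>
    obtain ⟨k, k1, k2⟩ := ih (hd.subset (Set.subset_insert _ _))
      (fun U hU => hh U (Set.mem_insert_of_mem _ hU))
    have hdV : ∀ U ∈ 𝒱, ∀ x ∈ V, x ∉ U := by
      intro U hU x hx hxU
      have hne : V ≠ U := fun e => hV (e ▸ hU)
      exact (hd (Set.mem_insert _ _) (Set.mem_insert_of_mem _ hU) hne).le_bot ⟨hx, hxU⟩
    refine ⟨(h V).trans k, ?_, ?_⟩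
    · rintro U (rfl | hU) x hx
      · simp only [Homeomorph.trans_apply]
        apply k2
        intro U' hU' hx'
        exact hdV U' hU' _ (homeo_mem (hh U (Set.mem_insert _ _)) hx) hx'
      · simp only [Homeomorph.trans_apply]
        rw [hh V (Set.mem_insert _ _) x (fun hxV => hdV U hU x hxV hx), k1 U hU x hx]
    · intro x hx
      simp only [Homeomorph.trans_apply]
      rw [hh V (Set.mem_insert _ _) x (hx V (Set.mem_insert _ _))]
      exact k2 x fun U hU => hx U (Set.mem_insert_of_mem _ hU)

/-- Equal or in the same member of the family. -/
def SameCell (𝒱 : Set (Set E)) (a b : E) : Prop := a = b ∨ ∃ V ∈ 𝒱, a ∈ V ∧ b ∈ V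

lemma full_step [FiniteDimensional ℝ E] (hE : 2 < Module.finrank ℝ E)
    (hX : ∀ O : Set X, IsOpen O → O.Nonempty → O.Infinite)
    {f : X → E} (hf : Continuous f) (hfi : Function.Injective f)
    {C : Set E} (hC : IsCompact C) (hCd : IsTotallyDisconnected C) {ε ε' : ℝ} (hε' : 0 < ε')
    {𝒱 : Set (Set E)} (h𝒱 : GoodFam f C ε 𝒱) :
    ∃ g : X → E, Continuous g ∧ Function.Injective g ∧ (∀ x, SameCell 𝒱 (g x) (f x)) ∧
      ∃ 𝒲 : Set (Set E), GoodFam g C ε' 𝒲 ∧ ∀ W ∈ 𝒲, ∃ V ∈ 𝒱, closure W ⊆ V := by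
  classical
  have hcomp : ∀ V ∈ 𝒱, IsCompact (C ∩ V) := by
    intro u hu
    have : C ∩ u = C \ ⋃₀ (𝒱 \ {u}) := by
      ext y
      constructor
      · rintro ⟨hy, hyu⟩
        refine ⟨hy, ?_⟩
        rintro ⟨v, ⟨hv, hvu⟩, hyv⟩
        exact (h𝒱.disj hv hu hvu).le_bot ⟨hyv, hyu⟩
      · rintro ⟨hy, hyn⟩
        refine ⟨hy, ?_⟩
        obtain ⟨v, hv, hyv⟩ := h𝒱.cover hy
        by_cases e : v = u
        · exact e ▸ hyv
        · exact absurd ⟨v, ⟨hv, e⟩, hyv⟩ hyn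
    rw [this]
    exact hC.diff (isOpen_sUnion fun v hv => h𝒱.isOpen v hv.1)
  have hstep : ∀ V ∈ 𝒱, ∃ h : E ≃ₜ E, (∀ x ∉ V, h x = x) ∧ ∃ W : Set (Set E),
      GoodFam (fun x => h (f x)) (C ∩ V) ε' W ∧ ∀ w ∈ W, closure w ⊆ V := by
    intro V hV
    obtain ⟨x0, hx0⟩ := h𝒱.meets V hV
    exact one_step hE hX hf hfi (h𝒱.isOpen V hV) (h𝒱.conn V hV) (hcomp V hV)
      (fun t ht => hCd t (ht.trans Set.inter_subset_left)) Set.inter_subset_right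
      (fun x hx => h𝒱.avoid x hx.1) hx0 hε'
  choose! h hid W hW hWcl using hstep
  obtain ⟨k, k1, k2⟩ := glue h𝒱.fin h𝒱.disj h hid
  have hsame : ∀ x, SameCell 𝒱 (k (f x)) (f x) := by
    intro x
    by_cases hx : ∃ V ∈ 𝒱, f x ∈ V
    · obtain ⟨V, hV, hxV⟩ := hx
      right
      refine ⟨V, hV, ?_, hxV⟩
      rw [k1 V hV _ hxV]
      exact homeo_mem (hid V hV) hxV
    · left
      push Not at hx
      exact k2 _ hx
  have hback : ∀ V ∈ 𝒱, ∀ x, k (f x) ∈ V → k (f x) = h V (f x) := by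
    intro V hV x hx
    rcases hsame x with e | ⟨V', hV', h1, h2⟩
    · exact k1 V hV _ (e ▸ hx)
    · have : V' = V := by
        by_contra hne
        exact (h𝒱.disj hV' hV hne).le_bot ⟨h1, hx⟩
      subst this
      exact k1 V' hV' _ h2
  have hfwd : ∀ V ∈ 𝒱, ∀ x, h V (f x) ∈ V → k (f x) = h V (f x) := by
    intro V hV x hx
    by_cases hxV : f x ∈ V
    · exact k1 V hV _ hxV
    · rw [hid V hV _ hxV] at hx
      exact absurd hx hxV
  have hsub : ∀ V ∈ 𝒱, ∀ w ∈ W V, w ⊆ V := fun V hV w hw => subset_closure.trans (hWcl V hV w hw)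
  refine ⟨fun x => k (f x), k.continuous.comp hf, k.injective.comp hfi, hsame, ⋃ V ∈ 𝒱, W V,
    ⟨h𝒱.fin.biUnion fun V hV => (hW V hV).fin, ?_, ?_, ?_, ?_, ?_, ?_, ?_, ?_⟩, ?_⟩
  · intro w hw
    obtain ⟨V, hV, hw⟩ := Set.mem_iUnion₂.1 hw
    exact (hW V hV).isOpen w hw
  · intro w hw
    obtain ⟨V, hV, hw⟩ := Set.mem_iUnion₂.1 hw
    exact (hW V hV).conn w hw
  · intro w hw
    obtain ⟨V, hV, hw⟩ := Set.mem_iUnion₂.1 hw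
    obtain ⟨x, hx⟩ := (hW V hV).meets w hw
    refine ⟨x, ?_⟩
    rw [hfwd V hV x (hsub V hV w hw hx)]
    exact hx
  · intro w hw
    obtain ⟨V, hV, hw⟩ := Set.mem_iUnion₂.1 hw
    exact (hW V hV).small w hw
  · intro w hw x y hx hy
    obtain ⟨V, hV, hw⟩ := Set.mem_iUnion₂.1 hw
    have hx' := hback V hV x (hsub V hV w hw hx)
    have hy' := hback V hV y (hsub V hV w hw hy)
    exact (hW V hV).small' w hw x y (hx' ▸ hx) (hy' ▸ hy)
  · intro w hw w' hw' hne
    obtain ⟨V, hV, hw⟩ := Set.mem_iUnion₂.1 hw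
    obtain ⟨V', hV', hw'⟩ := Set.mem_iUnion₂.1 hw'
    by_cases e : V = V'
    · subst e
      exact (hW V hV).disj hw hw' hne
    · exact (h𝒱.disj hV hV' e).mono (hsub V hV w hw) (hsub V' hV' w' hw')
  · intro c hc
    obtain ⟨V, hV, hcV⟩ := h𝒱.cover hc
    obtain ⟨w, hw, hcw⟩ := (hW V hV).cover ⟨hc, hcV⟩
    exact ⟨w, Set.mem_biUnion hV hw, hcw⟩
  · intro x hx
    obtain ⟨V, hV, hcV⟩ := h𝒱.cover hx
    have e := hback V hV x hcV
    exact (hW V hV).avoid x (by rw [← e]; exact ⟨hx, hcV⟩)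
  · intro w hw
    obtain ⟨V, hV, hw⟩ := Set.mem_iUnion₂.1 hw
    exact ⟨V, hV, hWcl V hV w hw⟩

end PartThree

/-! ### Part 4: passing to the limit -/

section PartFour

open Filter

variable {E : Type*} [NormedAddCommGroup E] [NormedSpace ℝ E]

lemma SameCell.symm' {𝒱 : Set (Set E)} {a b : E} (h : SameCell 𝒱 a b) : SameCell 𝒱 b a := by
  rcases h with h | ⟨V, hV, ha, hb⟩
  · exact Or.inl h.symm
  · exact Or.inr ⟨V, hV, hb, ha⟩

lemma SameCell.trans' {𝒱 : Set (Set E)} (hd : 𝒱.PairwiseDisjoint id) {a b c : E}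
    (h : SameCell 𝒱 a b) (h' : SameCell 𝒱 b c) : SameCell 𝒱 a c := by
  rcases h with rfl | ⟨V, hV, ha, hb⟩
  · exact h'
  rcases h' with rfl | ⟨V', hV', hb', hc⟩
  · exact Or.inr ⟨V, hV, ha, hb⟩
  have : V = V' := by
    by_contra hne
    exact (hd hV hV' hne).le_bot ⟨hb, hb'⟩
  subst this
  exact Or.inr ⟨V, hV, ha, hc⟩

lemma SameCell.coarsen {𝒱 𝒲 : Set (Set E)} (h : ∀ W ∈ 𝒲, ∃ V ∈ 𝒱, closure W ⊆ V) {a b : E}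
    (hab : SameCell 𝒲 a b) : SameCell 𝒱 a b := by
  rcases hab with rfl | ⟨W, hW, ha, hb⟩
  · exact Or.inl rfl
  · obtain ⟨V, hV, hWV⟩ := h W hW
    exact Or.inr ⟨V, hV, hWV (subset_closure ha), hWV (subset_closure hb)⟩

variable {X : Type*} [MetricSpace X] [CompactSpace X]

lemma limit_exists [FiniteDimensional ℝ E] (ε : ℕ → ℝ) (hε0 : Tendsto ε atTop (𝓝 0))
    (hεp : ∀ k, 0 < ε k)
    {C : Set E} (f : ℕ → X → E) (𝒱 : ℕ → Set (Set E))
    (hfc : ∀ k, Continuous (f k)) (hfi : ∀ k, Function.Injective (f k))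
    (hG : ∀ k, GoodFam (f k) C (ε k) (𝒱 k))
    (hs : ∀ k x, SameCell (𝒱 k) (f (k + 1) x) (f k x))
    (hr : ∀ k, ∀ W ∈ 𝒱 (k + 1), ∃ V ∈ 𝒱 k, closure W ⊆ V) :
    ∃ F : X → E, IsEmbedding F ∧ C ⊆ Set.range F := by
  have hcomplete : CompleteSpace E := FiniteDimensional.complete ℝ E
  have hdist : ∀ k a b, SameCell (𝒱 k) a b → dist a b ≤ ε k := by
    rintro k a b (rfl | ⟨V, hV, ha, hb⟩)
    · simpa using (hεp k).le
    · exact (hG k).small V hV a ha b hb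
  have hco : ∀ k d a b, SameCell (𝒱 (k + d)) a b → SameCell (𝒱 k) a b := by
    intro k d
    induction d with
    | zero => intro a b h; exact h
    | succ d ih => intro a b h; exact ih a b (SameCell.coarsen (hr (k + d)) h)
  have hsd : ∀ k d x, SameCell (𝒱 k) (f (k + d) x) (f k x) := by
    intro k d x
    induction d with
    | zero => exact Or.inl rfl
    | succ d ih => exact SameCell.trans' (hG k).disj (hco k d _ _ (hs (k + d) x)) ih
  have hsj : ∀ k j x, k ≤ j → SameCell (𝒱 k) (f j x) (f k x) := by
    intro k j x hkj
    obtain ⟨d, rfl⟩ := Nat.exists_eq_add_of_le hkj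
    exact hsd k d x
  have hcau : ∀ x, CauchySeq (fun k => f k x) := fun x =>
    cauchySeq_of_le_tendsto_0' ε (fun k j hkj => by
      rw [dist_comm]; exact hdist k _ _ (hsj k j x hkj)) hε0
  choose F hF using fun x => cauchySeq_tendsto_of_complete (hcau x)
  have hFs : ∀ k x, SameCell (𝒱 k) (F x) (f k x) := by
    intro k x
    refine SameCell.trans' (hG k).disj ?_ (hs k x)
    by_cases hV : ∃ V ∈ 𝒱 (k + 1), f (k + 1) x ∈ V
    · obtain ⟨V, hV, hfV⟩ := hV
      obtain ⟨V', hV', hVV'⟩ := hr k V hV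
      refine Or.inr ⟨V', hV', hVV' ?_, hVV' (subset_closure hfV)⟩
      refine mem_closure_of_tendsto (hF x) ?_
      filter_upwards [eventually_ge_atTop (k + 1)] with j hj
      rcases hsj (k + 1) j x hj with h | ⟨W, hW, h1, h2⟩
      · rw [h]; exact hfV
      · have : W = V := by
          by_contra hne
          exact ((hG (k + 1)).disj hW hV hne).le_bot ⟨h2, hfV⟩
        exact this ▸ h1
    · left
      refine tendsto_nhds_unique (hF x) (tendsto_const_nhds.congr' ?_)
      filter_upwards [eventually_ge_atTop (k + 1)] with j hj
      rcases hsj (k + 1) j x hj with h | ⟨W, hW, h1, h2⟩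
      · exact h.symm
      · exact absurd ⟨W, hW, h2⟩ hV
  have hFc : Continuous F := by
    refine TendstoUniformly.continuous (F := f) (p := atTop) ?_ (Frequently.of_forall hfc)
    rw [Metric.tendstoUniformly_iff]
    intro e he
    filter_upwards [hε0.eventually (gt_mem_nhds he)] with k hk x
    exact (hdist k _ _ (hFs k x)).trans_lt hk
  have hFi : Function.Injective F := by
    intro x y hxy
    by_contra hne
    obtain ⟨k, hk⟩ := (hε0.eventually (gt_mem_nhds (dist_pos.2 hne))).exists
    have h1 : SameCell (𝒱 k) (f k x) (f k y) :=
      SameCell.trans' (hG k).disj (hFs k x).symm' (hxy ▸ hFs k y)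
    rcases h1 with h | ⟨V, hV, h1, h2⟩
    · exact hne (hfi k h)
    · exact absurd ((hG k).small' V hV x y h1 h2) (not_le.2 hk)
  refine ⟨F, (hFc.isClosedEmbedding hFi).isEmbedding, ?_⟩
  intro z hz
  have hcl : IsClosed (Set.range F) := (isCompact_range hFc).isClosed
  rw [← hcl.closure_eq, Metric.mem_closure_iff]
  intro e he
  obtain ⟨k, hk⟩ := (hε0.eventually (gt_mem_nhds (half_pos he))).exists
  obtain ⟨V, hV, hzV⟩ := (hG k).cover hz
  obtain ⟨x, hx⟩ := (hG k).meets V hV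
  refine ⟨F x, ⟨x, rfl⟩, ?_⟩
  have h1 := (hG k).small V hV z hzV _ hx
  have h2 := hdist k _ _ (hFs k x)
  have h3 := dist_triangle_right z (F x) (f k x)
  linarith

lemma seq_exists [FiniteDimensional ℝ E] (hE : 2 < Module.finrank ℝ E)
    (hX : ∀ O : Set X, IsOpen O → O.Nonempty → O.Infinite)
    {f : X → E} (hf : Continuous f) (hfi : Function.Injective f)
    {C : Set E} (hC : IsCompact C) (hCd : IsTotallyDisconnected C) {M : ℝ} (hM : 0 < M)
    {𝒱 : Set (Set E)} (h𝒱 : GoodFam f C M 𝒱) :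
    ∃ F : X → E, IsEmbedding F ∧ C ⊆ Set.range F := by
  have hεp : ∀ k : ℕ, 0 < M * (1 / 2) ^ k := fun k => by positivity
  let S : ℕ → Type _ := fun k => {p : (X → E) × Set (Set E) //
    Continuous p.1 ∧ Function.Injective p.1 ∧ GoodFam p.1 C (M * (1 / 2) ^ k) p.2}
  have hstep : ∀ (k : ℕ) (p : S k), ∃ q : S (k + 1),
      (∀ x, SameCell p.1.2 (q.1.1 x) (p.1.1 x)) ∧
      ∀ W ∈ q.1.2, ∃ V ∈ p.1.2, closure W ⊆ V := by
    rintro k ⟨⟨g, 𝒲⟩, h1, h2, h3⟩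
    obtain ⟨g', a, b, c, 𝒲', d, e⟩ := full_step hE hX h1 h2 hC hCd (hεp (k + 1)) h3
    exact ⟨⟨⟨g', 𝒲'⟩, a, b, d⟩, c, e⟩
  choose nxt hn1 hn2 using hstep
  let s0 : S 0 := ⟨⟨f, 𝒱⟩, hf, hfi, by simpa using h𝒱⟩
  let s : ∀ k, S k := fun k => Nat.rec s0 (fun k p => nxt k p) k
  refine limit_exists (fun k => M * (1 / 2) ^ k) ?_ hεp (fun k => (s k).1.1) (fun k => (s k).1.2)
    (fun k => (s k).2.1) (fun k => (s k).2.2.1) (fun k => (s k).2.2.2)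
    (fun k => hn1 k (s k)) (fun k => hn2 k (s k))
  simpa using (tendsto_pow_atTop_nhds_zero_of_lt_one (r := (1 / 2 : ℝ)) (by norm_num)
    (by norm_num)).const_mul M

end PartFour

theorem stmt_1 (n : ℕ) (hn : 2 ≤ n)
    (C : Set (EuclideanSpace ℝ (Fin (n + 1)))) (hC : IsCantorSet C) :
    ∃ f : sphere (0 : EuclideanSpace ℝ (Fin (n + 1))) 1 → EuclideanSpace ℝ (Fin (n + 1)),
      Topology.IsEmbedding f ∧ C ⊆ Set.range f := by
  obtain ⟨-, hCc, -, hCd⟩ := hC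
  have hE : 2 < Module.finrank ℝ (EuclideanSpace ℝ (Fin (n + 1))) := by
    rw [finrank_euclideanSpace_fin]; omega
  have hrank : 1 < Module.rank ℝ (EuclideanSpace ℝ (Fin (n + 1))) := by
    rw [← Module.finrank_eq_rank]
    exact_mod_cast (by omega : 1 < Module.finrank ℝ (EuclideanSpace ℝ (Fin (n + 1))))
  have hnt : Nontrivial (EuclideanSpace ℝ (Fin (n + 1))) :=
    Module.nontrivial_of_finrank_pos (R := ℝ) (by omega)
  have hcs : CompactSpace (sphere (0 : EuclideanSpace ℝ (Fin (n + 1))) 1) :=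
    isCompact_iff_compactSpace.1 (isCompact_sphere _ _)
  obtain ⟨u, hu⟩ : (sphere (0 : EuclideanSpace ℝ (Fin (n + 1))) 1).Nonempty :=
    NormedSpace.sphere_nonempty.2 zero_le_one
  have hu1 : ‖u‖ = 1 := by simpa using hu
  have hX : ∀ O : Set (sphere (0 : EuclideanSpace ℝ (Fin (n + 1))) 1),
      IsOpen O → O.Nonempty → O.Infinite := by
    have hpc : ConnectedSpace (sphere (0 : EuclideanSpace ℝ (Fin (n + 1))) 1) :=
      isConnected_iff_connectedSpace.1 (isConnected_sphere hrank _ zero_le_one)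
    have hntS : Nontrivial (sphere (0 : EuclideanSpace ℝ (Fin (n + 1))) 1) := by
      refine ⟨⟨u, hu⟩, ⟨-u, by simpa using hu1⟩, fun h => ?_⟩
      have h2 : u = -u := congrArg Subtype.val h
      have h3 : u = 0 := by
        have h4 : (2 : ℝ) • u = 0 := by rw [two_smul]; nth_rewrite 2 [h2]; exact add_neg_cancel u
        exact (smul_eq_zero.1 h4).resolve_left two_ne_zero
      simp [h3] at hu1
    rintro O hO ⟨x, hx⟩
    exact infinite_of_mem_nhds x (hO.mem_nhds hx)
  obtain ⟨R, hR⟩ := hCc.isBounded.exists_norm_le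
  let L : ℝ := |R| + 2
  have hL : 2 ≤ L := by have := abs_nonneg R; simp only [L]; linarith
  have hCL : ∀ z ∈ C, ‖z‖ ≤ L - 2 := fun z hz => by
    have := hR z hz; have := le_abs_self R; simp only [L]; linarith
  let f : sphere (0 : EuclideanSpace ℝ (Fin (n + 1))) 1 → EuclideanSpace ℝ (Fin (n + 1)) :=
    fun x => x.1 + L • u
  have hLu : ‖L • u‖ = L := by
    rw [norm_smul, hu1, mul_one, Real.norm_eq_abs, abs_of_nonneg (by linarith)]
  have hx1 : ∀ x : sphere (0 : EuclideanSpace ℝ (Fin (n + 1))) 1, ‖x.1‖ = 1 := fun x => by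
    simpa using x.2
  have hf1 : ∀ x, ‖f x‖ ≤ L + 1 := fun x => by
    have := norm_add_le x.1 (L • u); rw [hLu, hx1] at this; simp only [f]; linarith
  have hf2 : ∀ x, L - 1 ≤ ‖f x‖ := fun x => by
    have := norm_sub_le (x.1 + L • u) x.1
    rw [add_sub_cancel_left, hLu, hx1] at this; simp only [f]; linarith
  refine seq_exists hE hX (f := f) (by fun_prop) ?_ hCc hCd (M := 2 * (L + 2)) (by linarith)
    (𝒱 := {ball 0 (L + 2)}) ?_
  · intro x y hxy
    exact Subtype.ext (add_right_cancel hxy)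
  refine ⟨Set.finite_singleton _, ?_, ?_, ?_, ?_, ?_, Set.pairwiseDisjoint_singleton _ _, ?_, ?_⟩
  · rintro w rfl; exact isOpen_ball
  · rintro w rfl; exact (convex_ball _ _).isPreconnected
  · rintro w rfl; exact ⟨⟨u, hu⟩, by have := hf1 ⟨u, hu⟩; rw [mem_ball_zero_iff]; linarith⟩
  · rintro w rfl a ha b hb
    rw [mem_ball_zero_iff] at ha hb
    have := norm_sub_le a b
    rw [dist_eq_norm]; linarith
  · rintro w rfl x y - -
    have := norm_sub_le x.1 y.1
    rw [Subtype.dist_eq, dist_eq_norm]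
    rw [hx1, hx1] at this; linarith
  · intro z hz
    refine ⟨_, rfl, ?_⟩
    have := hCL z hz
    rw [mem_ball_zero_iff]; linarith
  · intro x hx
    have := hCL _ hx
    have := hf2 x
    linarith
end

section
/- For every integer n ≥ 2 and all real numbers τ > 0 and δ > 0, there exists a C^∞ function η : ℝⁿ → ℝ such that: the support of η is contained in the closed ball of radius δ/2 centered at 0; 0 ≤ η(x) ≤ τ for all x; there exists δ' > 0 such that η ≡ τ on the ball of radius δ' centered at 0; and ∫_{ℝⁿ} ‖∇η(x)‖ⁿ dx < δⁿ. -/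
open MeasureTheory

lemma aux_sum {E : Type*} [NormedAddCommGroup E] (n N : ℕ) (hn : n ≠ 0) (a : ℕ → E)
    (h : ∀ j k, j < k → a j ≠ 0 → a k = 0) :
    ‖∑ k ∈ Finset.range N, a k‖ₑ ^ n ≤ ∑ k ∈ Finset.range N, ‖a k‖ₑ ^ n := by
  by_cases hk : ∃ k ∈ Finset.range N, a k ≠ 0
  · obtain ⟨k, hkN, hk⟩ := hk
    rw [Finset.sum_eq_single k]
    · exact Finset.single_le_sum (f := fun k => ‖a k‖ₑ ^ n) (fun _ _ => zero_le) hkN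
    · intro j _ hj
      rcases lt_or_gt_of_ne hj with hj | hj
      · by_contra h0
        exact hk (h j k hj h0)
      · exact h k j hj hk
    · intro h1
      exact absurd hkN h1
  · push Not at hk
    rw [Finset.sum_eq_zero hk]
    simp [hn]

lemma aux_scale (n : ℕ) (c : ℝ) (hc : 0 < c) (g : EuclideanSpace ℝ (Fin n) → ENNReal)
    (hg : Measurable g) :
    ∫⁻ x, ENNReal.ofReal (c ^ n) * g (c • x) = ∫⁻ x, g x := by
  have hm := Measure.map_addHaar_smul (volume : Measure (EuclideanSpace ℝ (Fin n))) hc.ne'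
  have h1 : ∫⁻ x, g (c • x) = ∫⁻ y, g y ∂(Measure.map (c • ·) volume) := by
    rw [lintegral_map hg (measurable_const_smul c)]
  have hm2 : Measurable fun x : EuclideanSpace ℝ (Fin n) => g (c • x) :=
    hg.comp (measurable_const_smul c)
  rw [lintegral_const_mul _ hm2, h1, hm, lintegral_smul_measure,
    finrank_euclideanSpace, Fintype.card_fin, smul_eq_mul, ← mul_assoc,
    ← ENNReal.ofReal_mul (by positivity), abs_of_pos (by positivity),
    mul_inv_cancel₀ (by positivity)]
  simp

theorem stmt_6 (n : ℕ) (hn : 2 ≤ n) (τ δ : ℝ) (hτ : 0 < τ) (hδ : 0 < δ) :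
    ∃ η : EuclideanSpace ℝ (Fin n) → ℝ,
      ContDiff ℝ (⊤ : ℕ∞) η ∧
      tsupport η ⊆ Metric.closedBall 0 (δ / 2) ∧
      (∀ x, 0 ≤ η x ∧ η x ≤ τ) ∧
      (∃ δ' > 0, ∀ x ∈ Metric.ball (0 : EuclideanSpace ℝ (Fin n)) δ', η x = τ) ∧
      ∫⁻ x, (‖gradient η x‖₊ : ENNReal) ^ n < ENNReal.ofReal (δ ^ n) := by
  let φ : ContDiffBump (0 : EuclideanSpace ℝ (Fin n)) :=
    ⟨δ / 4, δ / 2, by positivity, by linarith⟩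
  have hφ : ContDiff ℝ (⊤ : ℕ∞) φ := φ.contDiff
  have hd : Differentiable ℝ φ := hφ.differentiable (by simp)
  have hcont : Continuous (fderiv ℝ φ) := hφ.continuous_fderiv (by simp)
  have hcs : HasCompactSupport (fderiv ℝ φ) := φ.hasCompactSupport.fderiv (𝕜 := ℝ)
  set g : EuclideanSpace ℝ (Fin n) → ENNReal := fun x => ‖fderiv ℝ φ x‖ₑ ^ n with hgdef
  have hgm : Measurable g := (hcont.enorm.measurable).pow_const n
  have hfin : ∫⁻ x, g x < ⊤ := by
    have hi : Integrable (fun x => ‖fderiv ℝ φ x‖ ^ n) := by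
      refine (hcont.norm.pow n).integrable_of_hasCompactSupport ?_
      exact hcs.comp_left (g := fun y => ‖y‖ ^ n) (by simp; omega)
    have := hi.hasFiniteIntegral
    simpa [HasFiniteIntegral, enorm_pow, hgdef] using this
  set C : ℝ := (∫⁻ x, g x).toReal with hC
  have hCg : ∫⁻ x, g x = ENNReal.ofReal C := (ENNReal.ofReal_toReal hfin.ne).symm
  have hC0 : 0 ≤ C := ENNReal.toReal_nonneg
  obtain ⟨N, hN⟩ := exists_nat_gt (τ ^ n * C / δ ^ n)
  have hN0 : (0 : ℝ) < N := lt_of_le_of_lt (by positivity) hN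
  have hN1 : (1 : ℝ) ≤ N := by exact_mod_cast (by exact_mod_cast hN0 : 0 < N)
  -- vanishing of the derivative
  have hz_in : ∀ y : EuclideanSpace ℝ (Fin n), ‖y‖ < δ / 4 → fderiv ℝ φ y = 0 := by
    intro y hy
    have : (φ : EuclideanSpace ℝ (Fin n) → ℝ) =ᶠ[nhds y] fun _ => 1 :=
      φ.eventuallyEq_one_of_mem_ball (by simpa using hy)
    rw [this.fderiv_eq]; simp
  have hz_out : ∀ y : EuclideanSpace ℝ (Fin n), δ / 2 < ‖y‖ → fderiv ℝ φ y = 0 := by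
    intro y hy
    by_contra h
    have := support_fderiv_subset ℝ (f := φ) h
    rw [φ.tsupport_eq] at this
    have h2 : ‖y‖ ≤ δ / 2 := by simpa using this
    linarith
  let η : EuclideanSpace ℝ (Fin n) → ℝ :=
    fun x => ∑ k ∈ Finset.range N, (τ / N) * φ ((4 : ℝ) ^ k • x)
  have hder : ∀ x, HasFDerivAt η
      (∑ k ∈ Finset.range N, (τ / N * (4 : ℝ) ^ k) • fderiv ℝ φ ((4 : ℝ) ^ k • x)) x := by
    intro x
    refine HasFDerivAt.fun_sum fun k _ => ?_
    have h1 : HasFDerivAt (fun x : EuclideanSpace ℝ (Fin n) => (4 : ℝ) ^ k • x)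
        ((4 : ℝ) ^ k • ContinuousLinearMap.id ℝ _) x := 
      (hasFDerivAt_id (𝕜 := ℝ) x).fun_const_smul ((4 : ℝ) ^ k)
    have h2 := ((hd ((4 : ℝ) ^ k • x)).hasFDerivAt.comp x h1).const_mul (τ / N)
    refine HasFDerivAt.congr_fderiv (f := fun x => τ / N * φ ((4 : ℝ) ^ k • x)) h2 ?_
    ext v
    simp [mul_assoc]
  refine ⟨η, ?_, ?_, ?_, ?_, ?_⟩
  · exact ContDiff.sum fun k _ => contDiff_const.mul (hφ.comp (contDiff_const_smul _))
  · refine closure_minimal ?_ Metric.isClosed_closedBall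
    intro x hx
    by_contra hxb
    have hx' : δ / 2 < ‖x‖ := by simpa using hxb
    apply hx
    refine Finset.sum_eq_zero fun k _ => ?_
    rw [φ.zero_of_le_dist, mul_zero]
    rw [dist_zero_right, norm_smul, Real.norm_of_nonneg (by positivity)]
    have : (1 : ℝ) ≤ 4 ^ k := one_le_pow₀ (by norm_num)
    show δ / 2 ≤ _
    nlinarith [norm_nonneg x]
  · intro x
    refine ⟨Finset.sum_nonneg fun k _ => mul_nonneg (by positivity) φ.nonneg, ?_⟩
    calc η x ≤ ∑ k ∈ Finset.range N, (τ / N) * 1 :=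
          Finset.sum_le_sum fun k _ => mul_le_mul_of_nonneg_left φ.le_one (by positivity)
      _ = τ := by simp; field_simp
  · refine ⟨δ / 4 / 4 ^ N, by positivity, fun x hx => ?_⟩
    have hx' : ‖x‖ < δ / 4 / 4 ^ N := by simpa using hx
    rw [lt_div_iff₀ (by positivity)] at hx'
    calc η x = ∑ k ∈ Finset.range N, (τ / N) * 1 := by
          refine Finset.sum_congr rfl fun k hk => ?_
          rw [φ.one_of_mem_closedBall]
          rw [mem_closedBall_zero_iff, norm_smul, Real.norm_of_nonneg (by positivity)]
          have : (4 : ℝ) ^ k ≤ 4 ^ N :=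
            pow_le_pow_right₀ (by norm_num) (Finset.mem_range.1 hk).le
          show _ ≤ δ / 4
          nlinarith [norm_nonneg x]
      _ = τ := by simp; field_simp
  · have hpt : ∀ x, (‖gradient η x‖₊ : ENNReal) ^ n ≤ ∑ k ∈ Finset.range N,
        ENNReal.ofReal ((τ / N) ^ n) *
          (ENNReal.ofReal (((4 : ℝ) ^ k) ^ n) * g ((4 : ℝ) ^ k • x)) := by
      intro x
      have e1 : (‖gradient η x‖₊ : ENNReal) = ‖fderiv ℝ η x‖ₑ := by
        rw [← enorm_eq_nnnorm, ← ofReal_norm, ← ofReal_norm, gradient, LinearIsometryEquiv.norm_map]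
      rw [e1, (hder x).fderiv]
      refine (aux_sum n N (by omega) _ ?_).trans (le_of_eq ?_)
      · intro j k hjk hj
        have hj' : fderiv ℝ φ ((4 : ℝ) ^ j • x) ≠ 0 := fun h => hj (by rw [h, smul_zero])
        have h1 : δ / 4 ≤ ‖(4 : ℝ) ^ j • x‖ := by
          by_contra h
          exact hj' (hz_in _ (not_le.1 h))
        rw [hz_out, smul_zero]
        rw [norm_smul, Real.norm_of_nonneg (by positivity)] at h1 ⊢
        have h4 : (4 : ℝ) ^ (j + 1) ≤ 4 ^ k := pow_le_pow_right₀ (by norm_num) hjk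
        rw [pow_succ] at h4
        nlinarith [norm_nonneg x, mul_le_mul_of_nonneg_right h4 (norm_nonneg x)]
      · refine Finset.sum_congr rfl fun k _ => ?_
        rw [enorm_smul, mul_pow, Real.enorm_of_nonneg (by positivity),
          ← ENNReal.ofReal_pow (by positivity), mul_pow, ENNReal.ofReal_mul (by positivity),
          mul_assoc]
    refine (lintegral_mono hpt).trans_lt ?_
    have hmk : ∀ k : ℕ, Measurable fun x : EuclideanSpace ℝ (Fin n) =>
        ENNReal.ofReal (((4 : ℝ) ^ k) ^ n) * g ((4 : ℝ) ^ k • x) := fun k =>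
      (hgm.comp (measurable_const_smul _)).const_mul _
    rw [lintegral_finsetSum _ fun k _ => (hmk k).const_mul _]
    have : ∀ k ∈ Finset.range N, ∫⁻ x, ENNReal.ofReal ((τ / N) ^ n) *
          (ENNReal.ofReal (((4 : ℝ) ^ k) ^ n) * g ((4 : ℝ) ^ k • x)) =
          ENNReal.ofReal ((τ / N) ^ n * C) := by
      intro k _
      rw [lintegral_const_mul _ (hmk k), aux_scale n _ (by positivity) g hgm, hCg,
        ENNReal.ofReal_mul (by positivity)]
    rw [Finset.sum_congr rfl this, Finset.sum_const, Finset.card_range, nsmul_eq_mul,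
      ← ENNReal.ofReal_natCast, ← ENNReal.ofReal_mul (by positivity)]
    refine (ENNReal.ofReal_lt_ofReal_iff (by positivity)).2 ?_
    rw [div_lt_iff₀ (by positivity)] at hN
    have hp : (N : ℝ) ^ 2 ≤ N ^ n := pow_le_pow_right₀ hN1 hn
    rw [div_pow]
    calc (N : ℝ) * (τ ^ n / N ^ n * C) = N * (τ ^ n * C) / N ^ n := by ring
      _ ≤ N * (τ ^ n * C) / N ^ 2 := by gcongr
      _ = τ ^ n * C / N := by field_simp
      _ < δ ^ n := by rw [div_lt_iff₀ hN0]; linarith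
end

section
/- Let m ≥ 2 be an integer, let C ⊆ ℝ^m be a compact totally disconnected set, let a, b ∈ ℝ^m \ C with a ≠ b, and let ε > 0. Then there exists an injective C^∞ curve γ : [0, 1] → ℝ^m with γ(0) = a, γ(1) = b, γ'(t) ≠ 0 for all t, whose image is disjoint from C and contained in the ε-neighborhood of the line segment [a, b] = {a + t(b − a) : t ∈ [0,1]}. -/
open Set Topology

theorem no_log (a : ℂ) (R : ℝ) (hR : 0 < R) (s : ℂ → ℂ) (hs : Continuous s)
    (h0 : ∀ z, s z ≠ 0) (hb : ∀ z, ‖z - a‖ = R → s z = z - a) : False := by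
  obtain ⟨g, ⟨-, hg⟩, -⟩ := Complex.isCoveringMapOn_exp.existsUnique_continuousMap_lifts
    ⟨s, hs⟩ (a₀ := (0 : ℂ)) (Complex.exp_log (h0 0)) (fun x => h0 x)
  have hg' : ∀ z, Complex.exp (g z) = s z := fun z => congrFun hg z
  let h : ℝ → ℂ := fun t => g (a + R * Complex.exp (t * Complex.I)) - t * Complex.I
  have hc : Continuous h := by fun_prop
  have hexp : ∀ t, Complex.exp (h t) = R := by
    intro t
    simp only [h]
    rw [Complex.exp_sub, hg', hb]
    · rw [add_sub_cancel_left, mul_div_assoc, div_self (Complex.exp_ne_zero _), mul_one]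
    · simp [Complex.norm_exp_ofReal_mul_I, abs_of_pos hR]
  have key : h = fun _ => h 0 := by
    refine Complex.isCoveringMap_exp.eq_of_comp_eq hc continuous_const ?_ 0 rfl
    funext t
    apply Subtype.ext
    simp [hexp]
  have h2 := congrFun key (2 * Real.pi)
  have e1 : Complex.exp (((2 * Real.pi : ℝ) : ℂ) * Complex.I) = 1 := by
    push_cast
    exact Complex.exp_two_pi_mul_I
  simp only [h, e1] at h2
  simp [Real.pi_ne_zero] at h2

theorem frontier_component {K : Set ℂ} (hK : IsClosed K) (a : ℂ) :
    frontier (connectedComponentIn Kᶜ a) ⊆ K := by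
  intro x hx
  by_contra hxK
  have hxo : IsOpen (connectedComponentIn Kᶜ x) := hK.isOpen_compl.connectedComponentIn
  have hao : IsOpen (connectedComponentIn Kᶜ a) := hK.isOpen_compl.connectedComponentIn
  rw [hao.frontier_eq] at hx
  obtain ⟨y, hy1, hy2⟩ := mem_closure_iff.1 hx.1 _ hxo (mem_connectedComponentIn hxK)
  apply hx.2
  rw [connectedComponentIn_eq hy2, ← connectedComponentIn_eq hy1]
  exact mem_connectedComponentIn hxK

theorem eilenberg {K : Set ℂ} (hK : IsClosed K) (a b : ℂ) (ha : a ∉ K) (hb : b ∉ K)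
    (hbd : Bornology.IsBounded (connectedComponentIn Kᶜ a)) (L : ℂ → ℂ) (hL : ContinuousOn L K)
    (hLe : ∀ z ∈ K, Complex.exp (L z) * (z - b) = z - a) :
    b ∈ connectedComponentIn Kᶜ a := by
  classical
  by_contra hbA
  set A := connectedComponentIn Kᶜ a with hA
  have hao : IsOpen A := hK.isOpen_compl.connectedComponentIn
  have hfr : frontier A ⊆ K := frontier_component hK a
  have haA : a ∈ A := mem_connectedComponentIn ha
  obtain ⟨M, hM⟩ := ContinuousMap.exists_restrict_eq hK ⟨K.domRestrict L, hL.domRestrict⟩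
  have hM' : ∀ z ∈ K, M z = L z := fun z hz => by
    exact congrArg (fun f => f ⟨z, hz⟩) hM
  let s : ℂ → ℂ := A.piecewise (fun z => Complex.exp (M z) * (z - b)) (fun z => z - a)
  have hs : Continuous s := by
    refine continuous_piecewise ?_ ?_ ?_
    · intro x hx
      rw [hM' x (hfr hx), hLe x (hfr hx)]
    · fun_prop
    · fun_prop
  have h0 : ∀ z, s z ≠ 0 := by
    intro z
    by_cases hz : z ∈ A
    · simp only [s, piecewise_eq_of_mem _ _ _ hz]
      refine mul_ne_zero (Complex.exp_ne_zero _) (sub_ne_zero.2 ?_)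
      rintro rfl
      exact hbA hz
    · simp only [s, piecewise_eq_of_notMem _ _ _ hz]
      refine sub_ne_zero.2 ?_
      rintro rfl
      exact hz haA
  obtain ⟨R, hR0, hR⟩ := hbd.subset_ball_lt 0 a
  refine no_log a R hR0 s hs h0 ?_
  intro z hz
  have : z ∉ A := fun h => by
    have := hR h
    rw [Metric.mem_ball, dist_eq_norm] at this
    linarith
  simp only [s, piecewise_eq_of_notMem _ _ _ this]

theorem clopen_log {C N S : Set ℂ} (hC : IsCompact C) (hCt : IsTotallyDisconnected C)
    (hN : IsOpen N) (hS : IsCompact S) (hSC : S ⊆ C) (hSN : S ⊆ N) (f : ℂ → ℂ)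
    (hf : ContinuousOn f C) (hf0 : ∀ z ∈ C, f z ≠ 0) :
    ∃ D, ∃ L : ℂ → ℂ, D ⊆ C ∧ IsClosed D ∧ IsClosed (C \ D) ∧ D ⊆ N ∧ S ⊆ D ∧
      ContinuousOn L D ∧ ∀ z ∈ D, Complex.exp (L z) = f z := by
  classical
  refine IsCompact.induction_on (p := fun S => ∃ D, ∃ L : ℂ → ℂ, D ⊆ C ∧ IsClosed D ∧
    IsClosed (C \ D) ∧ D ⊆ N ∧ S ⊆ D ∧ ContinuousOn L D ∧ ∀ z ∈ D, Complex.exp (L z) = f z)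
    hS ?_ ?_ ?_ ?_
  · exact ⟨∅, 0, by simp [hC.isClosed]⟩
  · intro s t hst ht
    obtain ⟨D, L, h1, h2, h3, h4, h5, h6⟩ := ht
    exact ⟨D, L, h1, h2, h3, h4, hst.trans h5, h6⟩
  · intro s t hs ht
    obtain ⟨D, L, h1, h2, h3, h4, h5, h6, h7⟩ := hs
    obtain ⟨D', L', h1', h2', h3', h4', h5', h6', h7'⟩ := ht
    refine ⟨D ∪ D', D.piecewise L L', union_subset h1 h1', h2.union h2', ?_,
      union_subset h4 h4', union_subset_union h5 h5', ?_, ?_⟩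
    · rw [← sdiff_inter_sdiff]; exact h3.inter h3'
    · have e : D ∪ D' = D ∪ (D' ∩ (C \ D)) := by
        ext x; constructor
        · rintro (h | h)
          · exact Or.inl h
          · by_cases hx : x ∈ D
            · exact Or.inl hx
            · exact Or.inr ⟨h, h1' h, hx⟩
        · rintro (h | h)
          · exact Or.inl h
          · exact Or.inr h.1
      rw [e]
      refine ContinuousOn.union_of_isClosed ?_ ?_ h2 (h2'.inter h3)
      · exact h6.congr fun x hx => piecewise_eq_of_mem _ _ _ hx
      · exact (h6'.mono inter_subset_left).congr fun x hx => piecewise_eq_of_notMem _ _ _ hx.2.2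
    · intro z hz
      by_cases hx : z ∈ D
      · rw [piecewise_eq_of_mem _ _ _ hx, h7 z hx]
      · rw [piecewise_eq_of_notMem _ _ _ hx, h7' z (hz.resolve_left hx)]
  · intro x hx
    have : CompactSpace C := isCompact_iff_compactSpace.1 hC
    have : TotallyDisconnectedSpace C := totallyDisconnectedSpace_subtype_iff.2 hCt
    have hxC := hSC hx
    have hcf : Continuous (fun y : C => f y / f x) :=
      (continuousOn_iff_continuous_domRestrict.1 hf).div_const _
    have hU : IsOpen {y : C | f y / f x ∈ Complex.slitPlane ∧ (y : ℂ) ∈ N} :=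
      (Complex.isOpen_slitPlane.preimage hcf).inter (hN.preimage continuous_subtype_val)
    obtain ⟨V, hV, hxV, hVU⟩ := compact_exists_isClopen_in_isOpen hU
      (x := ⟨x, hxC⟩) ⟨by simp [div_self (hf0 x hxC)], hSN hx⟩
    have hd : C \ ((↑) '' V) = ((↑) : C → ℂ) '' Vᶜ := by
      ext y
      simp only [mem_sdiff, mem_image, Subtype.exists, mem_compl_iff]
      constructor
      · rintro ⟨h, h'⟩
        exact ⟨y, h, fun hh => h' ⟨y, h, hh, rfl⟩, rfl⟩
      · rintro ⟨z, hz, h, rfl⟩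
        exact ⟨hz, fun ⟨w, hw, h1, h2⟩ => h (by subst h2; exact h1)⟩
    have hcl : IsClosed (C \ (((↑) : C → ℂ) '' V)) := by
      rw [hd]
      exact hC.isClosed.isClosedEmbedding_subtypeVal.isClosedMap _ hV.compl.1
    refine ⟨(↑) '' V, ?_, (↑) '' V, fun y => Complex.log (f x) + Complex.log (f y / f x), ?_, ?_, hcl, ?_, le_rfl, ?_, ?_⟩
    · refine mem_nhdsWithin.2 ⟨(C \ (((↑) : C → ℂ) '' V))ᶜ, hcl.isOpen_compl, ?_, ?_⟩
      · rintro ⟨_, h⟩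
        exact h ⟨_, hxV, rfl⟩
      · rintro y ⟨hy, hyS⟩
        by_contra h
        exact hy ⟨hSC hyS, h⟩
    · rintro _ ⟨y, -, rfl⟩; exact y.2
    · exact hC.isClosed.isClosedEmbedding_subtypeVal.isClosedMap _ hV.1
    · rintro _ ⟨y, hy, rfl⟩; exact (hVU hy).2
    · refine continuousOn_const.add (ContinuousOn.clog ?_ ?_)
      · refine (hf.mono ?_).div_const _
        rintro _ ⟨y, -, rfl⟩; exact y.2
      · rintro _ ⟨y, hy, rfl⟩; exact (hVU hy).1
    · rintro _ ⟨y, hy, rfl⟩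
      rw [Complex.exp_add, Complex.exp_log (hf0 x hxC), Complex.exp_log, mul_div_cancel₀ _ (hf0 x hxC)]
      exact div_ne_zero (hf0 _ y.2) (hf0 x hxC)

theorem slit_of_notMem_segment {a b z : ℂ} (hz : z ∉ segment ℝ a b) :
    (z - a) / (z - b) ∈ Complex.slitPlane := by
  by_contra h
  apply hz
  have hzb : z - b ≠ 0 := fun h => hz (by rw [sub_eq_zero.1 h]; exact right_mem_segment _ _ _)
  rw [Complex.mem_slitPlane_iff_not_le_zero, not_not] at h
  obtain ⟨r, hr, hre⟩ : ∃ r : ℝ, 0 ≤ r ∧ (z - a) / (z - b) = -(r : ℂ) := by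
    refine ⟨-((z - a) / (z - b)).re, ?_, ?_⟩
    · have := (Complex.le_def.1 h).1
      simpa using this
    · have := (Complex.le_def.1 h).2
      apply Complex.ext <;> simp
      simpa using this
  rw [div_eq_iff hzb] at hre
  have h1 : (1 + r) ≠ 0 := by positivity
  have h1' : (1 + (r : ℂ)) ≠ 0 := by exact_mod_cast h1
  refine ⟨1 / (1 + r), r / (1 + r), by positivity, by positivity, by field_simp, ?_⟩
  simp only [Complex.real_smul]
  push_cast
  field_simp
  linear_combination -hre

theorem plane_connected {C N : Set ℂ} (hC : IsCompact C) (hCt : IsTotallyDisconnected C)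
    (hN : IsOpen N) (hNb : Bornology.IsBounded N) (a b : ℂ) (hseg : segment ℝ a b ⊆ N)
    (ha : a ∉ C) (hb : b ∉ C) : b ∈ connectedComponentIn (N \ C) a := by
  classical
  have hzb : ∀ z ∈ C, z - b ≠ 0 := fun z hz h => hb (by rw [← sub_eq_zero.1 h]; exact hz)
  have hza : ∀ z ∈ C, z - a ≠ 0 := fun z hz h => ha (by rw [← sub_eq_zero.1 h]; exact hz)
  have hsc : IsCompact (segment ℝ a b) := by
    rw [← convexHull_pair (𝕜 := ℝ)]
    exact (Set.toFinite {a, b}).isCompact_convexHull ℝ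
  obtain ⟨D, L, h1, h2, h3, h4, h5, h6, h7⟩ := clopen_log hC hCt hN (hC.inter hsc)
    inter_subset_left (inter_subset_right.trans hseg) (fun z => (z - a) / (z - b))
    (ContinuousOn.div (by fun_prop) (by fun_prop) hzb)
    (fun z hz => div_ne_zero (hza z hz) (hzb z hz))
  have hK : IsClosed (C ∪ Nᶜ) := hC.isClosed.union hN.isClosed_compl
  have e : N \ C = (C ∪ Nᶜ)ᶜ := by
    ext x; simp; tauto
  have hE : IsClosed ((C \ D) ∪ Nᶜ) := h3.union hN.isClosed_compl
  have e2 : C ∪ Nᶜ = D ∪ ((C \ D) ∪ Nᶜ) := by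
    rw [← union_assoc, union_sdiff_cancel h1]
  have hED : ∀ z ∈ (C \ D) ∪ Nᶜ, z ∉ D ∧ z ∉ segment ℝ a b := by
    rintro z (hz | hz)
    · exact ⟨hz.2, fun h => hz.2 (h5 ⟨hz.1, h⟩)⟩
    · exact ⟨fun h => hz (h4 h), fun h => hz (hseg h)⟩
  have hbn : ∀ z, z ∉ segment ℝ a b → z - b ≠ 0 := fun z hz h => hz (by
    rw [sub_eq_zero.1 h]; exact right_mem_segment _ _ _)
  have han : ∀ z, z ∉ segment ℝ a b → z - a ≠ 0 := fun z hz h => hz (by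
    rw [sub_eq_zero.1 h]; exact left_mem_segment _ _ _)
  have haN := hseg (left_mem_segment ℝ a b)
  have hbN := hseg (right_mem_segment ℝ a b)
  rw [e]
  refine eilenberg hK a b (by simp [ha, haN]) (by simp [hb, hbN]) (hNb.subset ?_)
    (D.piecewise L (fun z => Complex.log ((z - a) / (z - b)))) ?_ ?_
  · rw [← e]
    exact (connectedComponentIn_subset _ _).trans sdiff_subset
  · rw [e2]
    refine ContinuousOn.union_of_isClosed ?_ ?_ h2 hE
    · exact h6.congr fun x hx => piecewise_eq_of_mem _ _ _ hx
    · refine ContinuousOn.congr (f := fun z => Complex.log ((z - a) / (z - b))) ?_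
        fun x hx => piecewise_eq_of_notMem _ _ _ (hED x hx).1
      refine ContinuousOn.clog (ContinuousOn.div (by fun_prop) (by fun_prop) ?_) ?_
      · exact fun z hz => hbn z (hED z hz).2
      · exact fun z hz => slit_of_notMem_segment (hED z hz).2
  · rw [e2]
    rintro z (hz | hz)
    · rw [piecewise_eq_of_mem _ _ _ hz, h7 z hz, div_mul_cancel₀ _ (hzb z (h1 hz))]
    · have := (hED z hz).2
      rw [piecewise_eq_of_notMem _ _ _ (hED z hz).1, Complex.exp_log, div_mul_cancel₀ _ (hbn z this)]
      exact div_ne_zero (han z this) (hbn z this)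

/-- Smooth, bi-Lipschitz from below, and the identity off `U`. -/
def GoodMap (U : Set ℂ) (Φ : ℂ → ℂ) : Prop :=
  ContDiff ℝ (⊤ : ℕ∞) Φ ∧ (∃ c : ℝ, 0 < c ∧ ∀ x y, c * ‖x - y‖ ≤ ‖Φ x - Φ y‖) ∧ ∀ x ∉ U, Φ x = x

theorem GoodMap.injective {U : Set ℂ} {Φ : ℂ → ℂ} (h : GoodMap U Φ) : Function.Injective Φ := by
  intro x y hxy
  obtain ⟨-, ⟨c, hc, hcc⟩, -⟩ := h
  have := hcc x y
  rw [hxy, sub_self, norm_zero] at this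
  have h2 : ‖x - y‖ ≤ 0 := by
    by_contra hh
    push Not at hh
    nlinarith [mul_pos hc hh]
  exact sub_eq_zero.1 (norm_le_zero_iff.1 h2)

theorem GoodMap.mapsTo {U : Set ℂ} {Φ : ℂ → ℂ} (h : GoodMap U Φ) {x : ℂ} (hx : x ∈ U) :
    Φ x ∈ U := by
  by_contra hh
  have := h.injective (h.2.2 _ hh)
  rw [this] at hh
  exact hh hx

theorem GoodMap.comp {U : Set ℂ} {Φ Ψ : ℂ → ℂ} (h : GoodMap U Φ) (h' : GoodMap U Ψ) :
    GoodMap U (Φ ∘ Ψ) := by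
  obtain ⟨h1, ⟨c, hc, hcc⟩, h3⟩ := h
  obtain ⟨h1', ⟨c', hc', hcc'⟩, h3'⟩ := h'
  refine ⟨h1.comp h1', ⟨c * c', by positivity, fun x y => ?_⟩, fun x hx => ?_⟩
  · calc c * c' * ‖x - y‖ = c * (c' * ‖x - y‖) := by ring
      _ ≤ c * ‖Ψ x - Ψ y‖ := by gcongr; exact hcc' x y
      _ ≤ _ := hcc _ _
  · simp [h3' x hx, h3 x hx]

theorem GoodMap.exists_near {U : Set ℂ} (hU : IsOpen U) {x : ℂ} (hx : x ∈ U) :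
    ∃ δ > 0, ∀ y ∈ Metric.ball x δ, ∀ z ∈ Metric.ball x δ, ∃ Φ, GoodMap U Φ ∧ Φ y = z := by
  obtain ⟨r, hr, hrU⟩ := Metric.isOpen_iff.1 hU x hx
  let β : ContDiffBump x := ⟨r / 3, r / 2, by positivity, by linarith⟩
  have hβ : ContDiff ℝ (⊤ : ℕ∞) (β : ℂ → ℝ) := β.contDiff
  obtain ⟨K, hK⟩ := hβ.lipschitzWith_of_hasCompactSupport β.hasCompactSupport (by simp)
  refine ⟨min (r / 3) (1 / (4 * (K + 1))), by positivity, fun y hy z hz => ?_⟩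
  have hy1 : dist y x < r / 3 := lt_of_lt_of_le hy (min_le_left _ _)
  have hy2 : dist y x < 1 / (4 * (K + 1)) := lt_of_lt_of_le hy (min_le_right _ _)
  have hz2 : dist z x < 1 / (4 * (K + 1)) := lt_of_lt_of_le hz (min_le_right _ _)
  have hzy : ‖z - y‖ ≤ 1 / (2 * (K + 1)) := by
    rw [← dist_eq_norm]
    have := dist_triangle_right z y x
    have e : (1 : ℝ) / (2 * (K + 1)) = 1 / (4 * (K + 1)) + 1 / (4 * (K + 1)) := by
      field_simp; norm_num
    linarith
  refine ⟨fun w => w + β w • (z - y), ⟨?_, ⟨1 / 2, by norm_num, fun u v => ?_⟩, fun u hu => ?_⟩, ?_⟩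
  · exact contDiff_id.add (hβ.smul contDiff_const)
  · have h1 : |β u - β v| ≤ K * ‖u - v‖ := by
      have := hK.dist_le_mul u v
      rwa [Real.dist_eq, dist_eq_norm] at this
    have h2 : ‖(β u - β v) • (z - y)‖ ≤ 1 / 2 * ‖u - v‖ := by
      rw [norm_smul, Real.norm_eq_abs]
      calc |β u - β v| * ‖z - y‖ ≤ (K * ‖u - v‖) * (1 / (2 * (K + 1))) := by gcongr
        _ = (K / (K + 1)) * (1 / 2 * ‖u - v‖) := by field_simp
        _ ≤ 1 * (1 / 2 * ‖u - v‖) := by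
          gcongr
          rw [div_le_one (by positivity)]
          linarith
        _ = _ := one_mul _
    have e : u + β u • (z - y) - (v + β v • (z - y)) = (u - v) + (β u - β v) • (z - y) := by
      rw [sub_smul]; abel
    have h3 := norm_sub_le_norm_add (u - v) ((β u - β v) • (z - y))
    rw [e]
    linarith
  · have : β u = 0 := by
      apply β.zero_of_le_dist
      by_contra hh
      push Not at hh
      apply hu
      apply hrU
      rw [Metric.mem_ball]
      have : β.rOut = r / 2 := rfl
      linarith
    simp [this]
  · have : β y = 1 := by
      apply β.one_of_mem_closedBall
      rw [Metric.mem_closedBall]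
      exact hy1.le
    simp [this]

theorem GoodMap.exists_map {U : Set ℂ} (hU : IsOpen U) {p q : ℂ} (hp : p ∈ U)
    (hq : q ∈ connectedComponentIn U p) : ∃ Φ, GoodMap U Φ ∧ Φ p = q := by
  refine IsPreconnected.induction₂' (s := connectedComponentIn U p)
    isPreconnected_connectedComponentIn (fun x y => ∃ Φ, GoodMap U Φ ∧ Φ x = y) ?_ ?_
    (mem_connectedComponentIn hp) hq
  · intro x hx
    obtain ⟨δ, hδ, h⟩ := GoodMap.exists_near hU (connectedComponentIn_subset _ _ hx)
    have : Metric.ball x δ ∈ 𝓝[connectedComponentIn U p] x :=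
      mem_nhdsWithin_of_mem_nhds (Metric.ball_mem_nhds x hδ)
    filter_upwards [this] with y hy
    have hxx := Metric.mem_ball_self (x := x) hδ
    exact ⟨h x hxx y hy, h y hy x hxx⟩
  · rintro x y z - - - ⟨Φ, h, rfl⟩ ⟨Ψ, h', rfl⟩
    exact ⟨Ψ ∘ Φ, h'.comp h, rfl⟩

theorem deriv_ne_zero_of_expand {γ : ℝ → ℂ} {c : ℝ} (hc : 0 < c) (t : ℝ)
    (hd : DifferentiableAt ℝ γ t) (h : ∀ s, c * |s - t| ≤ ‖γ s - γ t‖) : deriv γ t ≠ 0 := by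
  have h1 := (hasDerivAt_iff_tendsto_slope.1 hd.hasDerivAt).norm
  have h2 : c ≤ ‖deriv γ t‖ := by
    refine ge_of_tendsto h1 ?_
    filter_upwards [self_mem_nhdsWithin] with s hs
    have hs' : 0 < |s - t| := abs_pos.2 (sub_ne_zero.2 hs)
    rw [slope_def_module, norm_smul, norm_inv, Real.norm_eq_abs, inv_mul_eq_div, le_div_iff₀ hs']
    exact h s
  exact norm_pos_iff.1 (hc.trans_le h2)

theorem insert_td {C : Set ℂ} (hC : IsClosed C) (hCt : IsTotallyDisconnected C) {x : ℂ}
    (hx : x ∉ C) : IsTotallyDisconnected (insert x C) := by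
  intro t ht htc
  have hd : Disjoint {x} C := by simpa using hx
  rcases isPreconnected_iff_subset_of_disjoint_closed.1 htc {x} C isClosed_singleton hC
    (by rwa [singleton_union]) (by rw [hd.inter_eq, inter_empty]) with h | h
  · exact subsingleton_singleton.anti h
  · exact hCt t h htc

theorem plane_arc {C N : Set ℂ} (hC : IsCompact C) (hCt : IsTotallyDisconnected C)
    (hN : IsOpen N) (hNb : Bornology.IsBounded N) (hseg : segment ℝ (0 : ℂ) 1 ⊆ N)
    (ha : (0 : ℂ) ∉ C) (hb : (1 : ℂ) ∉ C) :
    ∃ γ : ℝ → ℂ, ContDiff ℝ (⊤ : ℕ∞) γ ∧ Function.Injective γ ∧ γ 0 = 0 ∧ γ 1 = 1 ∧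
      (∀ t, deriv γ t ≠ 0) ∧ ∀ t ∈ Icc (0 : ℝ) 1, γ t ∈ N \ C := by
  obtain ⟨r, hr, hrC⟩ := Metric.isOpen_iff.1 hC.isClosed.isOpen_compl 0 ha
  have hmem : ∀ t : ℝ, t ∈ Icc (0 : ℝ) 1 → (t : ℂ) ∈ N := fun t ht =>
    hseg ⟨1 - t, t, by linarith [ht.2], ht.1, by ring, by simp⟩
  obtain ⟨δ, hδ0, hδ1, hδr⟩ : ∃ δ : ℝ, 0 < δ ∧ δ < 1 ∧ δ < r :=
    ⟨min r 1 / 2, by positivity, by linarith [min_le_right r 1, lt_min hr one_pos],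
      by linarith [min_le_left r 1, lt_min hr one_pos]⟩
  have hCδ : ∀ t : ℝ, t ∈ Icc (0 : ℝ) δ → (t : ℂ) ∉ C := fun t ht => hrC (by
    rw [mem_ball_zero_iff, Complex.norm_real, Real.norm_eq_abs, abs_of_nonneg ht.1]
    linarith [ht.2])
  have hδC : (δ : ℂ) ∉ insert 0 C := by
    rintro (h | h)
    · exact hδ0.ne' (by exact_mod_cast h)
    · exact hCδ δ ⟨hδ0.le, le_rfl⟩ h
  have hcomp : IsCompact (insert 0 C) := hC.insert 0
  have hconn := plane_connected hcomp (insert_td hC.isClosed hCt ha) hN hNb δ 1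
    (((convex_segment (𝕜 := ℝ) (0 : ℂ) 1).segment_subset
      ⟨1 - δ, δ, by linarith, hδ0.le, by ring, by simp⟩ (right_mem_segment _ _ _)).trans hseg) hδC
    (by rintro (h | h); exacts [one_ne_zero h, hb h])
  have hU : IsOpen (N \ insert 0 C) := hN.sdiff hcomp.isClosed
  obtain ⟨Φ, hΦ, hΦ1⟩ := GoodMap.exists_map hU ⟨hmem δ ⟨hδ0.le, hδ1.le⟩, hδC⟩ hconn
  have hcd : ContDiff ℝ (⊤ : ℕ∞) (fun t : ℝ => Φ ((t * δ : ℝ) : ℂ)) :=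
    hΦ.1.comp (Complex.ofRealCLM.contDiff.comp (contDiff_id.mul contDiff_const))
  have h00 : Φ 0 = 0 := hΦ.2.2 0 (by simp)
  refine ⟨fun t => Φ ((t * δ : ℝ) : ℂ), hcd, ?_, ?_, ?_, ?_, ?_⟩
  · intro s t hst
    have := Complex.ofReal_injective (hΦ.injective hst)
    exact mul_right_cancel₀ hδ0.ne' this
  · simpa using h00
  · simpa using hΦ1
  · intro t
    obtain ⟨c, hc, hcc⟩ := hΦ.2.1
    refine deriv_ne_zero_of_expand (c := c * δ) (by positivity) t
      ((hcd.differentiable (by simp)) t) fun s => ?_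
    refine le_trans (le_of_eq ?_) (hcc _ _)
    rw [← Complex.ofReal_sub, Complex.norm_real, Real.norm_eq_abs, ← sub_mul, abs_mul,
      abs_of_pos hδ0]
    ring
  · intro t ht
    rcases ht.1.eq_or_lt with rfl | h0
    · simp only [zero_mul, Complex.ofReal_zero, h00]
      exact ⟨by simpa using hmem 0 (by simp), ha⟩
    · have h1 : t * δ ≤ δ := by nlinarith [ht.2]
      have : ((t * δ : ℝ) : ℂ) ∈ N \ insert 0 C := by
        refine ⟨hmem _ ⟨by positivity, by linarith⟩, ?_⟩
        rintro (h | h)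
        · exact (mul_pos h0 hδ0).ne' (by exact_mod_cast h)
        · exact hCδ (t * δ) ⟨by positivity, h1⟩ h
      have := hΦ.mapsTo this
      exact ⟨this.1, fun h => this.2 (Or.inr h)⟩

theorem stmt_11 (m : ℕ) (hm : 2 ≤ m) (C : Set (EuclideanSpace ℝ (Fin m)))
    (hCc : IsCompact C) (hCtd : IsTotallyDisconnected C)
    (a b : EuclideanSpace ℝ (Fin m)) (ha : a ∉ C) (hb : b ∉ C) (hab : a ≠ b)
    (ε : ℝ) (hε : 0 < ε) :
    ∃ γ : ℝ → EuclideanSpace ℝ (Fin m),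
      ContDiff ℝ (⊤ : ℕ∞) γ ∧
      Set.InjOn γ (Set.Icc 0 1) ∧
      γ 0 = a ∧ γ 1 = b ∧
      (∀ t ∈ Set.Icc (0 : ℝ) 1, deriv γ t ≠ 0) ∧
      (γ '' Set.Icc 0 1) ∩ C = ∅ ∧
      γ '' Set.Icc 0 1 ⊆ Metric.thickening ε (segment ℝ a b) := by
  have hba : b - a ≠ 0 := sub_ne_zero.2 hab.symm
  obtain ⟨v, hv⟩ := exists_linearIndependent_pair_of_one_lt_finrank (R := ℝ)
    (M := EuclideanSpace ℝ (Fin m)) (by simp; omega) hba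
  let T : ℂ →L[ℝ] EuclideanSpace ℝ (Fin m) :=
    Complex.reCLM.smulRight (b - a) + Complex.imCLM.smulRight v
  have hT : ∀ z, T z = z.re • (b - a) + z.im • v := fun z => rfl
  have hTi : Function.Injective T := by
    refine (injective_iff_map_eq_zero T).2 fun z hz => ?_
    rw [hT] at hz
    obtain ⟨h1, h2⟩ := LinearIndependent.pair_iff.1 hv _ _ hz
    exact Complex.ext h1 h2
  have hTe : IsClosedEmbedding T :=
    LinearMap.isClosedEmbedding_of_injective (f := (T : ℂ →ₗ[ℝ] EuclideanSpace ℝ (Fin m)))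
      (LinearMap.ker_eq_bot.2 hTi)
  let φ : ℂ → EuclideanSpace ℝ (Fin m) := fun z => a + T z
  have hφe : IsClosedEmbedding φ := (Homeomorph.addLeft a).isClosedEmbedding.comp hTe
  have hφ0 : φ 0 = a := by simp [φ]
  have hφ1 : φ 1 = b := by simp [φ, hT]
  have hseg : segment ℝ (0 : ℂ) 1 ⊆ φ ⁻¹' (Metric.thickening ε (segment ℝ a b)) := by
    rintro _ ⟨x, y, hx, hy, hxy, rfl⟩
    refine Metric.self_subset_thickening hε _ ⟨x, y, hx, hy, hxy, ?_⟩
    have : x = 1 - y := by linarith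
    subst this
    have e : φ ((1 - y) • (0 : ℂ) + y • (1 : ℂ)) = a + y • (b - a) := by
      simp [φ, hT]
    rw [e]
    module
  have hbd : Bornology.IsBounded (φ ⁻¹' (Metric.thickening ε (segment ℝ a b))) := by
    have h1 : IsCompact (segment ℝ a b) := by
      rw [← convexHull_pair (𝕜 := ℝ)]
      exact (Set.toFinite {a, b}).isCompact_convexHull ℝ
    have h2 : IsCompact (Metric.cthickening ε (segment ℝ a b)) := h1.cthickening
    exact (hφe.isCompact_preimage h2).isBounded.subset
      (preimage_mono (Metric.thickening_subset_cthickening _ _))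
  have htd : IsTotallyDisconnected (φ ⁻¹' C) := by
    intro t ht htc
    have := hCtd (φ '' t) (image_subset_iff.2 ht) (htc.image _ hφe.continuous.continuousOn)
    exact Set.subsingleton_of_image hφe.injective t this
  obtain ⟨γ, h1, h2, h3, h4, h5, h6⟩ := plane_arc (hφe.isCompact_preimage hCc) htd
    (Metric.isOpen_thickening.preimage hφe.continuous) hbd hseg
    (by simpa [hφ0] using ha) (by simpa [hφ1] using hb)
  refine ⟨fun t => φ (γ t), ?_, (hφe.injective.comp h2).injOn, ?_, ?_, ?_, ?_, ?_⟩
  · exact contDiff_const.add (T.contDiff.comp h1)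
  · simp only [h3, hφ0]
  · simp only [h4, hφ1]
  · intro t _
    have hd : HasDerivAt γ (deriv γ t) t := ((h1.differentiable (by simp)) t).hasDerivAt
    have := (T.hasFDerivAt.comp_hasDerivAt t hd).const_add a
    have e : deriv (fun t => φ (γ t)) t = T (deriv γ t) := this.deriv
    rw [e]
    intro h
    exact h5 t (hTi (by rw [h, map_zero]))
  · rw [← disjoint_iff_inter_eq_empty, disjoint_left]
    rintro _ ⟨t, ht, rfl⟩ h
    exact (h6 t ht).2 h
  · rintro _ ⟨t, ht, rfl⟩
    exact (h6 t ht).1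
end

section
/- Let L ⊆ ℝ³ be an affine line and let K ⊆ L be a compact, totally disconnected set. Then ℝ³ \ K is simply connected (in particular path-connected). -/
namespace S13

open Set unitInterval

abbrev E := ℝ × ℂ

section Convex
variable {V : Type*} [AddCommGroup V] [Module ℝ V] [TopologicalSpace V]
  [IsTopologicalAddGroup V] [ContinuousSMul ℝ V] {S : Set V}

/-- Straight segment as a path in the subtype. -/
def sg (x y : S) (h : segment ℝ x.1 y.1 ⊆ S) : Path x y where
  toFun t := ⟨AffineMap.lineMap x.1 y.1 (t : ℝ), h (by
    rw [segment_eq_image_lineMap]; exact ⟨t, t.2, rfl⟩)⟩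
  continuous_toFun := by
    refine Continuous.subtype_mk ?_ _
    simp only [AffineMap.lineMap_apply_module]
    fun_prop
  source' := by ext; simp
  target' := by ext; simp

theorem sg_mem {C : Set V} (hC : Convex ℝ C) {x y : S} (hx : x.1 ∈ C) (hy : y.1 ∈ C)
    (h : segment ℝ x.1 y.1 ⊆ S) (t : I) : (sg x y h t).1 ∈ C := by
  apply hC.segment_subset hx hy
  rw [segment_eq_image_lineMap]; exact ⟨t, t.2, rfl⟩

theorem homotopic_of_convex {C : Set V} (hC : Convex ℝ C) (hCS : C ⊆ S) {x y : S}
    (p q : Path x y) (hp : ∀ t, (p t).1 ∈ C) (hq : ∀ t, (q t).1 ∈ C) :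
    Path.Homotopic.Quotient.mk p = Path.Homotopic.Quotient.mk q := by
  rw [Path.Homotopic.Quotient.eq]
  have key : ∀ a : I × I, AffineMap.lineMap (p a.2).1 (q a.2).1 (a.1 : ℝ) ∈ C := by
    intro a
    apply hC.segment_subset (hp a.2) (hq a.2)
    rw [segment_eq_image_lineMap]; exact ⟨a.1, a.1.2, rfl⟩
  refine ⟨{ toFun := fun a => ⟨AffineMap.lineMap (p a.2).1 (q a.2).1 (a.1 : ℝ), hCS (key a)⟩
            continuous_toFun := ?_
            map_zero_left := ?_
            map_one_left := ?_
            prop' := ?_ }⟩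
  · refine Continuous.subtype_mk ?_ _
    simp only [AffineMap.lineMap_apply_module]
    fun_prop
  · intro a; ext; simp
  · intro a; ext; simp
  · intro t a ha
    rcases ha with rfl | rfl <;> simp

theorem trans_mem {C : Set V} {x y z : S} (p : Path x y) (q : Path y z)
    (hp : ∀ t, (p t).1 ∈ C) (hq : ∀ t, (q t).1 ∈ C) (t : I) : ((p.trans q) t).1 ∈ C := by
  have : (p.trans q) t ∈ Set.range (p.trans q) := ⟨t, rfl⟩
  rw [Path.trans_range] at this
  rcases this with ⟨s, hs⟩ | ⟨s, hs⟩
  · rw [← hs]; exact hp s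
  · rw [← hs]; exact hq s

/-- class of the straight segment -/
def sc (x y : S) (h : segment ℝ x.1 y.1 ⊆ S) : Path.Homotopic.Quotient x y :=
  Path.Homotopic.Quotient.mk (sg x y h)

theorem sc_trans {C : Set V} (hC : Convex ℝ C) (hCS : C ⊆ S) {x y z : S}
    (hx : x.1 ∈ C) (hy : y.1 ∈ C) (hz : z.1 ∈ C)
    (h₁ : segment ℝ x.1 y.1 ⊆ S) (h₂ : segment ℝ y.1 z.1 ⊆ S) :
    (sc x y h₁).trans (sc y z h₂) = sc x z ((hC.segment_subset hx hz).trans hCS) := by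
  unfold sc
  rw [← Path.Homotopic.Quotient.mk_trans]
  exact homotopic_of_convex hC hCS _ _
    (trans_mem _ _ (sg_mem hC hx hy _) (sg_mem hC hy hz _)) (sg_mem hC hx hz _)

end Convex

/-- Local-to-global criterion. -/
theorem simplyConnected_of_local {X : Type*} [TopologicalSpace X] (x0 : X)
    (c : ∀ x : X, Path.Homotopic.Quotient x x0)
    (H : ∀ x : X, ∃ U : Set X, IsOpen U ∧ x ∈ U ∧ ∀ (y z : X) (p : Path y z),
      (∀ t, p t ∈ U) → (Path.Homotopic.Quotient.mk p).trans (c z) = c y) :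
    SimplyConnectedSpace X := by
  choose U hUo hxU hU using H
  have main : ∀ (y z : X) (p : Path y z), (Path.Homotopic.Quotient.mk p).trans (c z) = c y := by
    intro y z p
    obtain ⟨t, t0, tm, ⟨n, hn⟩, ht⟩ := exists_monotone_Icc_subset_open_cover_unitInterval
      (c := fun x => p ⁻¹' (U x)) (fun x => (hUo x).preimage p.continuous)
      (fun s _ => mem_iUnion.2 ⟨p s, hxU _⟩)
    have step : ∀ m, (Path.Homotopic.Quotient.mk (p.subpath 0 (t m))).trans (c (p (t m)))
        = c (p 0) := by
      intro m
      induction m with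
      | zero =>
        obtain ⟨i, hi⟩ := ht 0
        apply hU i
        intro s
        have : (p.subpath 0 (t 0)) s ∈ range (p.subpath 0 (t 0)) := ⟨s, rfl⟩
        rw [Path.range_subpath] at this
        obtain ⟨r, hr, hr'⟩ := this
        rw [← hr']
        apply hi
        rw [t0] at hr; simp at hr
        rw [hr, t0]
        exact ⟨le_rfl, (t 1).2.1⟩
      | succ m ih =>
        obtain ⟨i, hi⟩ := ht m
        have h1 := hU i _ _ (p.subpath (t m) (t (m+1))) (by
          intro s
          have : (p.subpath (t m) (t (m+1))) s ∈ range (p.subpath (t m) (t (m+1))) := ⟨s, rfl⟩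
          rw [Path.range_subpath_of_le _ _ _ (tm (Nat.le_succ m))] at this
          obtain ⟨r, hr, hr'⟩ := this
          rw [← hr']
          exact hi hr)
        have h2 : Path.Homotopic.Quotient.mk (p.subpath 0 (t (m+1))) =
            (Path.Homotopic.Quotient.mk (p.subpath 0 (t m))).trans
              (Path.Homotopic.Quotient.mk (p.subpath (t m) (t (m+1)))) := by
          rw [← Path.Homotopic.Quotient.mk_trans, Path.Homotopic.Quotient.eq]
          exact ⟨(Path.Homotopy.subpathTransSubpath p 0 (t m) (t (m+1))).symm⟩
        rw [h2, Path.Homotopic.Quotient.trans_assoc, h1, ih]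
    have := step n
    rw [hn n le_rfl, Path.subpath_zero_one] at this
    have gen : ∀ (a b : X) (ha : a = y) (hb : b = z),
        (Path.Homotopic.Quotient.mk (p.cast ha hb)).trans (c b) = c a →
        (Path.Homotopic.Quotient.mk p).trans (c z) = c y := by
      rintro a b rfl rfl h
      exact h
    exact gen _ _ _ _ this
  rw [simply_connected_iff_paths_homotopic']
  refine ⟨⟨⟨x0⟩, fun x y => ?_⟩, fun {x y} p q => ?_⟩
  · obtain ⟨px, -⟩ := Path.Homotopic.Quotient.mk_surjective (c x)
    obtain ⟨py, -⟩ := Path.Homotopic.Quotient.mk_surjective (c y)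
    exact ⟨px.trans py.symm⟩
  · rw [← Path.Homotopic.Quotient.eq]
    have h := (main x y p).trans (main x y q).symm
    have h' := congrArg (fun w => w.trans (c y).symm) h
    simpa using h'

def SS (T : Set ℝ) : Set E := {x | x.2 ≠ 0 ∨ x.1 ∉ T}

/-- horizontal plane over `t` -/
theorem plane_conv (t : ℝ) : Convex ℝ ({t} ×ˢ univ : Set E) :=
  (convex_singleton t).prod convex_univ
theorem line_conv (z : ℂ) : Convex ℝ (univ ×ˢ {z} : Set E) :=
  convex_univ.prod (convex_singleton z)
theorem plane_sub {T : Set ℝ} {t : ℝ} (ht : t ∉ T) : ({t} ×ˢ univ : Set E) ⊆ SS T := by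
  rintro ⟨a, b⟩ ⟨h, -⟩
  right
  simp at h
  simpa [h] using ht
theorem line_sub {T : Set ℝ} {z : ℂ} (hz : z ≠ 0) : (univ ×ˢ {z} : Set E) ⊆ SS T := by
  rintro ⟨a, b⟩ ⟨-, h⟩
  left
  simp at h
  simpa [h] using hz

theorem hseg {T : Set ℝ} {t : ℝ} (ht : t ∉ T) (z w : ℂ) :
    segment ℝ ((t, z) : E) (t, w) ⊆ SS T :=
  ((plane_conv t).segment_subset (by simp) (by simp)).trans (plane_sub ht)
theorem vseg {T : Set ℝ} {z : ℂ} (hz : z ≠ 0) (t s : ℝ) :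
    segment ℝ ((t, z) : E) (s, z) ⊆ SS T :=
  ((line_conv z).segment_subset (by simp) (by simp)).trans (line_sub hz)

variable {T : Set ℝ}

/-- point with nonzero second coordinate -/
def pz (t : ℝ) {z : ℂ} (hz : z ≠ 0) : SS T := ⟨(t, z), Or.inl hz⟩

noncomputable def H {t : ℝ} (ht : t ∉ T) (z w : ℂ) :
    Path.Homotopic.Quotient (⟨(t, z), Or.inr ht⟩ : SS T) (⟨(t, w), Or.inr ht⟩ : SS T) :=
  sc _ _ (hseg ht z w)

noncomputable def W {z : ℂ} (hz : z ≠ 0) (t s : ℝ) :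
    Path.Homotopic.Quotient (⟨(t, z), Or.inl hz⟩ : SS T) (⟨(s, z), Or.inl hz⟩ : SS T) :=
  sc _ _ (vseg hz t s)

theorem H_trans {t : ℝ} (ht : t ∉ T) (z w u : ℂ) :
    (H ht z w).trans (H ht w u) = H ht z u :=
  sc_trans (plane_conv t) (plane_sub ht) (by simp) (by simp) (by simp) _ _

theorem W_trans {z : ℂ} (hz : z ≠ 0) (t s r : ℝ) :
    (W (T := T) hz t s).trans (W hz s r) = W hz t r :=
  sc_trans (line_conv z) (line_sub hz) (by simp) (by simp) (by simp) _ _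

theorem sq {t s : ℝ} (ht : t ∉ T) (hs : s ∉ T) {z w : ℂ} (hz : z ≠ 0) (hw : w ≠ 0)
    (h0 : (0 : ℂ) ∉ segment ℝ z w) :
    (H ht z w).trans (W hw t s) = (W hz t s).trans (H hs z w) := by
  have hC : Convex ℝ (univ ×ˢ segment ℝ z w : Set E) := convex_univ.prod (convex_segment z w)
  have hS : (univ ×ˢ segment ℝ z w : Set E) ⊆ SS T := by
    rintro ⟨a, b⟩ ⟨-, h⟩
    left
    rintro rfl
    exact h0 h
  have hz' := left_mem_segment ℝ z w
  have hw' := right_mem_segment ℝ z w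
  exact (sc_trans hC hS ⟨trivial, hz'⟩ ⟨trivial, hw'⟩ ⟨trivial, hw'⟩ _ _).trans
    (sc_trans hC hS ⟨trivial, hz'⟩ ⟨trivial, hz'⟩ ⟨trivial, hw'⟩ _ _).symm

theorem zero_seg_one {z : ℂ} (h : (0 : ℂ) ∈ segment ℝ z 1) : z.im = 0 := by
  obtain ⟨a, b, ha, hb, hab, h⟩ := h
  have h1 := congrArg Complex.re h
  have h2 := congrArg Complex.im h
  simp at h1 h2
  rcases h2 with rfl | h2
  · simp at h1 hab; linarith
  · exact h2

theorem zero_seg_I {z : ℂ} (h : (0 : ℂ) ∈ segment ℝ z Complex.I) : z.re = 0 := by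
  obtain ⟨a, b, ha, hb, hab, h⟩ := h
  have h1 := congrArg Complex.re h
  have h2 := congrArg Complex.im h
  simp at h1 h2
  rcases h1 with rfl | h1
  · simp at h2 hab; linarith
  · exact h1

theorem sq1 {t s : ℝ} (ht : t ∉ T) (hs : s ∉ T) {z : ℂ} (hz : z ≠ 0) :
    (H ht z 1).trans (W one_ne_zero t s) = (W hz t s).trans (H hs z 1) := by
  by_cases h0 : (0 : ℂ) ∈ segment ℝ z 1
  · have him := zero_seg_one h0
    have hI : (0 : ℂ) ∉ segment ℝ z Complex.I := fun h => hz (Complex.ext (zero_seg_I h) him)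
    have hI1 : (0 : ℂ) ∉ segment ℝ Complex.I 1 := fun h => by simpa using zero_seg_one h
    rw [← H_trans ht z Complex.I 1, ← H_trans hs z Complex.I 1,
      Path.Homotopic.Quotient.trans_assoc, sq ht hs Complex.I_ne_zero one_ne_zero hI1,
      ← Path.Homotopic.Quotient.trans_assoc, sq ht hs hz Complex.I_ne_zero hI,
      Path.Homotopic.Quotient.trans_assoc]
  · exact sq ht hs hz one_ne_zero h0

open Classical in
/-- canonical class to the base point -/
noncomputable def cc {t0 : ℝ} (h0 : t0 ∉ T) (x : SS T) :
    Path.Homotopic.Quotient x (⟨(t0, 1), Or.inr h0⟩ : SS T) :=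
  if h : x.1.1 ∉ T then (H h x.1.2 1).trans (W one_ne_zero x.1.1 t0)
  else (W (x.2.resolve_right h) x.1.1 t0).trans (H h0 x.1.2 1)

theorem cc_H {t0 : ℝ} (h0 : t0 ∉ T) {t : ℝ} (ht : t ∉ T) (z : ℂ) :
    cc h0 ⟨(t, z), Or.inr ht⟩ = (H ht z 1).trans (W one_ne_zero t t0) := by
  unfold cc
  rw [dif_pos ht]

theorem cc_W {t0 : ℝ} (h0 : t0 ∉ T) (t : ℝ) {z : ℂ} (hz : z ≠ 0) :
    cc h0 ⟨(t, z), Or.inl hz⟩ = (W hz t t0).trans (H h0 z 1) := by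
  by_cases ht : t ∈ T
  · unfold cc
    rw [dif_neg (not_not.2 ht)]
  · exact (cc_H h0 ht z).trans (sq1 ht h0 hz)

theorem H_cc {t0 : ℝ} (h0 : t0 ∉ T) {t : ℝ} (ht : t ∉ T) (z w : ℂ) :
    (H ht z w).trans (cc h0 ⟨(t, w), Or.inr ht⟩) = cc h0 ⟨(t, z), Or.inr ht⟩ := by
  rw [cc_H h0 ht, cc_H h0 ht, ← Path.Homotopic.Quotient.trans_assoc, H_trans]

theorem W_cc {t0 : ℝ} (h0 : t0 ∉ T) (t s : ℝ) {z : ℂ} (hz : z ≠ 0) :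
    (W hz t s).trans (cc h0 ⟨(s, z), Or.inl hz⟩) = cc h0 ⟨(t, z), Or.inl hz⟩ := by
  rw [cc_W h0 _ hz, cc_W h0 _ hz, ← Path.Homotopic.Quotient.trans_assoc, W_trans]

theorem SS_simply (hT : IsClosed T) (hd : Dense Tᶜ) : IsSimplyConnected (SS T) := by
  obtain ⟨t0, h0⟩ := hd.nonempty
  have hopen : IsOpen (SS T) :=
    (isOpen_ne_fun continuous_snd continuous_const).union
      (hT.isOpen_compl.preimage continuous_fst)
  refine simplyConnected_of_local _ (cc h0) ?_
  rintro ⟨x, hx⟩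
  obtain ⟨r, hr, hB⟩ := Metric.isOpen_iff.1 hopen x hx
  refine ⟨Subtype.val ⁻¹' Metric.ball x r, Metric.isOpen_ball.preimage continuous_subtype_val,
    Metric.mem_ball_self hr, ?_⟩
  have hC : Convex ℝ (Metric.ball x r) := convex_ball x r
  obtain ⟨t1, ht1b, ht1⟩ := hd.exists_mem_open (Metric.isOpen_ball (x := x.1) (ε := r))
    ⟨x.1, Metric.mem_ball_self hr⟩ |>.imp fun a h => And.symm h
  obtain ⟨z1, hz1, hz1b⟩ := (dense_compl_singleton (0 : ℂ)).exists_mem_open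
    (Metric.isOpen_ball (x := x.2) (ε := r)) ⟨x.2, Metric.mem_ball_self hr⟩
  have hz1 : z1 ≠ 0 := hz1
  have hbox : Metric.ball x r = Metric.ball x.1 r ×ˢ Metric.ball x.2 r :=
    (ball_prod_same x.1 x.2 r).symm
  have key : ∀ y : SS T, y.1 ∈ Metric.ball x r →
      ∃ q : Path y (⟨(t1, z1), Or.inr ht1⟩ : SS T), (∀ t, (q t).1 ∈ Metric.ball x r) ∧
        (Path.Homotopic.Quotient.mk q).trans (cc h0 _) = cc h0 y := by
    rintro ⟨⟨t, z⟩, hy⟩ hyb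
    have hyb' := hyb
    rw [hbox] at hyb'
    obtain ⟨htb, hzb⟩ := hyb'
    simp only at htb hzb
    have m1 : (t1, z1) ∈ Metric.ball x r := by rw [hbox]; exact ⟨ht1b, hz1b⟩
    by_cases hz : z = 0
    · have ht : t ∉ T := hy.resolve_left (not_not.2 hz)
      have m2 : (t, z1) ∈ Metric.ball x r := by rw [hbox]; exact ⟨htb, hz1b⟩
      refine ⟨(sg _ _ (hseg ht z z1)).trans (sg ⟨(t, z1), Or.inr ht⟩ _ (vseg hz1 t t1)),
        trans_mem _ _ (sg_mem hC hyb m2 _) (sg_mem hC m2 m1 _), ?_⟩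
      rw [Path.Homotopic.Quotient.mk_trans, Path.Homotopic.Quotient.trans_assoc]
      exact (congrArg _ (W_cc h0 t t1 hz1)).trans (H_cc h0 ht z z1)
    · have m2 : (t1, z) ∈ Metric.ball x r := by rw [hbox]; exact ⟨ht1b, hzb⟩
      refine ⟨(sg _ _ (vseg hz t t1)).trans (sg ⟨(t1, z), Or.inl hz⟩ _ (hseg ht1 z z1)),
        trans_mem _ _ (sg_mem hC hyb m2 _) (sg_mem hC m2 m1 _), ?_⟩
      rw [Path.Homotopic.Quotient.mk_trans, Path.Homotopic.Quotient.trans_assoc]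
      exact (congrArg _ (H_cc h0 ht1 z z1)).trans (W_cc h0 t t1 hz)
  intro y z p hp
  obtain ⟨qy, hqy, ey⟩ := key y (by simpa using hp 0)
  obtain ⟨qz, hqz, ez⟩ := key z (by simpa using hp 1)
  rw [← ez, ← ey, ← Path.Homotopic.Quotient.trans_assoc, ← Path.Homotopic.Quotient.mk_trans,
    homotopic_of_convex hC hB (p.trans qz) qy (trans_mem _ _ hp hqz) hqy]

end S13

theorem stmt_13 (p v : EuclideanSpace ℝ (Fin 3)) (hv : v ≠ 0)
    (K : Set (EuclideanSpace ℝ (Fin 3)))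
    (hKL : K ⊆ Set.range fun t : ℝ => p + t • v)
    (hKc : IsCompact K) (hKtd : IsTotallyDisconnected K) :
    SimplyConnectedSpace ↥(Kᶜ) ∧ IsPathConnected Kᶜ := by
  have hf : Continuous fun t : ℝ => p + t • v := by fun_prop
  have hinj : Function.Injective fun t : ℝ => p + t • v := by
    intro a b h
    exact smul_left_injective ℝ hv (add_left_cancel h)
  let T : Set ℝ := (fun t : ℝ => p + t • v) ⁻¹' K
  have hT : IsClosed T := hKc.isClosed.preimage hf
  have hd : Dense Tᶜ := by
    rw [← interior_eq_empty_iff_dense_compl, Set.eq_empty_iff_forall_notMem]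
    intro t ht
    obtain ⟨r, hr, hB⟩ := Metric.isOpen_iff.1 isOpen_interior t ht
    have hB' : Metric.ball t r ⊆ T := hB.trans interior_subset
    have hpre : IsPreconnected ((fun t : ℝ => p + t • v) '' Metric.ball t r) :=
      ((convex_ball t r).isPreconnected).image _ hf.continuousOn
    have hs := hKtd _ (Set.image_subset_iff.2 hB') hpre
    have h1 := hs (Set.mem_image_of_mem _ (Metric.mem_ball_self hr))
      (Set.mem_image_of_mem _ (show t + r / 2 ∈ Metric.ball t r by
        simp [Real.dist_eq, abs_of_pos hr]; linarith))
    have := hinj h1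
    linarith
  let e : EuclideanSpace ℝ (Fin 3) ≃L[ℝ] ℝ × ℂ := ContinuousLinearEquiv.ofFinrankEq (by simp)
  obtain ⟨A, hA⟩ := SeparatingDual.exists_continuousLinearEquiv_apply_eq (R := ℝ)
    (x := e v) (y := ((1, 0) : ℝ × ℂ)) (by simpa using hv) (by simp)
  let B : EuclideanSpace ℝ (Fin 3) ≃L[ℝ] ℝ × ℂ := e.trans A
  have hB : B v = (1, 0) := hA
  let h : EuclideanSpace ℝ (Fin 3) ≃ₜ ℝ × ℂ := (Homeomorph.subRight p).trans B.toHomeomorph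
  have hh : ∀ x, h x = B (x - p) := fun x => rfl
  have hpre : Kᶜ = h ⁻¹' (S13.SS T) := by
    ext x
    have hx : (h x).2 = 0 → x = p + (h x).1 • v := by
      intro h2
      have : B (x - p) = B ((h x).1 • v) := by
        rw [map_smul, hB, ← hh]
        ext <;> simp [h2]
      rw [← B.injective this]; abel
    have hx' : ∀ t : ℝ, h (p + t • v) = (t, 0) := by
      intro t
      rw [hh, add_sub_cancel_left, map_smul, hB]; simp
    simp only [Set.mem_compl_iff, Set.mem_preimage, S13.SS, Set.mem_setOf_eq]
    rw [← not_iff_not, not_not, not_or, not_not, not_not]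
    constructor
    · intro hxK
      obtain ⟨t, rfl⟩ := hKL hxK
      simp only [hx']
      exact ⟨trivial, hxK⟩
    · rintro ⟨h2, h1⟩
      rw [hx h2]; exact h1
  have hsc : IsSimplyConnected Kᶜ := by
    rw [hpre, Homeomorph.isSimplyConnected_preimage]
    exact S13.SS_simply hT hd
  exact ⟨hsc, hsc.isPathConnected⟩
end
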